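/- Let K be an algebraically closed field of characteristic 0, G a reductive algebraic group over K, and H a closed subgroup of G containing a maximal torus of G. Then every homomorphism of algebraic groups from H to the additive group G_a is trivial. -/

import Mathlib

open Matrix MvPolynomial

variable {K : Type} [Field K]

/-- The entries and inverse-entries of an element of `GL (Fin n) K`, as a valuation of
variables; used to express Zariski-closedness and polynomiality on `GL n`. -/
def matOf {n : ℕ} (A : GL (Fin n) K) : (Fin n × Fin n) ⊕ (Fin n × Fin n) → K :=
  Sum.elim (fun q => (A : Matrix (Fin n) (Fin n) K) q.1 q.2)
           (fun q => ((A⁻¹ : GL (Fin n) K) : Matrix (Fin n) (Fin n) K) q.1 q.2)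

/-- A subset of `GL n K` is Zariski closed if it is the common zero locus of a family of
polynomials in the matrix entries and the entries of the inverse matrix. -/
def IsZClosed {n : ℕ} (s : Set (GL (Fin n) K)) : Prop :=
  ∃ I : Set (MvPolynomial ((Fin n × Fin n) ⊕ (Fin n × Fin n)) K),
    s = {A | ∀ p ∈ I, eval (matOf A) p = 0}

/-- A subgroup of `GL n K` is connected (for the Zariski topology). -/
def IsConnectedSG {n : ℕ} (H : Subgroup (GL (Fin n) K)) : Prop :=
  ∀ s t : Set (GL (Fin n) K), IsZClosed s → IsZClosed t →
    (H : Set (GL (Fin n) K)) ⊆ s ∪ t → (H : Set (GL (Fin n) K)) ∩ s ∩ t = ∅ →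
    (H : Set (GL (Fin n) K)) ⊆ s ∨ (H : Set (GL (Fin n) K)) ⊆ t

/-- A function on a subgroup of `GL n K` is a polynomial (regular) function if it is given by
a polynomial in the matrix entries and inverse-matrix entries. -/
def IsPolyFun {n : ℕ} (H : Subgroup (GL (Fin n) K)) (f : H → K) : Prop :=
  ∃ p : MvPolynomial ((Fin n × Fin n) ⊕ (Fin n × Fin n)) K,
    ∀ A : H, f A = eval (matOf (A : GL (Fin n) K)) p

/-- A homomorphism of linear algebraic groups: a group homomorphism which is regular. -/
structure AlgGroupHom {n m : ℕ} (H : Subgroup (GL (Fin n) K)) (H' : Subgroup (GL (Fin m) K)) where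
  toFun : H →* H'
  poly : ∀ i j : Fin m,
    IsPolyFun H (fun A => ((toFun A : GL (Fin m) K) : Matrix (Fin m) (Fin m) K) i j)

/-- A homomorphism of algebraic groups from `H` to the additive group `G_a`. -/
structure GaHom {n : ℕ} (H : Subgroup (GL (Fin n) K)) where
  toFun : H → K
  map_mul : ∀ A B : H, toFun (A * B) = toFun A + toFun B
  poly : IsPolyFun H toFun

/-- Base change `GL n K → GL n K̄`. -/
noncomputable def glBaseChange {n : ℕ} : GL (Fin n) K →* GL (Fin n) (AlgebraicClosure K) :=
  Units.map ((algebraMap K (AlgebraicClosure K)).mapMatrix.toMonoidHom)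

/-- A torus: a Zariski-closed connected subgroup which is diagonalizable over the algebraic
closure. -/
def IsTorus {n : ℕ} (T : Subgroup (GL (Fin n) K)) : Prop :=
  IsZClosed (T : Set (GL (Fin n) K)) ∧ IsConnectedSG T ∧
  ∃ g : GL (Fin n) (AlgebraicClosure K), ∀ A ∈ T,
    Matrix.IsDiag
      ((g * glBaseChange A * g⁻¹ : GL (Fin n) (AlgebraicClosure K)) :
        Matrix (Fin n) (Fin n) (AlgebraicClosure K))

/-- `T` is a maximal torus of `G`. -/
def IsMaximalTorus {n : ℕ} (G T : Subgroup (GL (Fin n) K)) : Prop :=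
  IsTorus T ∧ T ≤ G ∧
    ∀ T' : Subgroup (GL (Fin n) K), IsTorus T' → T' ≤ G → T ≤ T' → T' = T

/-- A unipotent element of `GL n K`. -/
def IsUnipotentElt {n : ℕ} (A : GL (Fin n) K) : Prop :=
  ((A : Matrix (Fin n) (Fin n) K) - 1) ^ n = 0

/-- A (connected) reductive group: closed, connected, with trivial unipotent radical, i.e.
every Zariski-closed connected normal subgroup consisting of unipotent elements is trivial. -/
def IsReductive {n : ℕ} (G : Subgroup (GL (Fin n) K)) : Prop :=
  IsZClosed (G : Set (GL (Fin n) K)) ∧ IsConnectedSG G ∧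
  ∀ U : Subgroup (GL (Fin n) K), U ≤ G → IsZClosed (U : Set (GL (Fin n) K)) →
    IsConnectedSG U → (∀ g ∈ G, ∀ u ∈ U, g * u * g⁻¹ ∈ U) →
    (∀ u ∈ U, IsUnipotentElt u) → U = ⊥

/-- A torus has rank `r` if it is isomorphic, as an algebraic group, to `G_m^r`. -/
def TorusHasRank {n : ℕ} (T : Subgroup (GL (Fin n) K)) (r : ℕ) : Prop :=
  ∃ e : T ≃* (Fin r → Kˣ),
    (∀ i : Fin r, IsPolyFun T (fun A => ((e A i : Kˣ) : K))) ∧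
    (∀ i j : Fin n, ∃ p : MvPolynomial (Fin r ⊕ Fin r) K, ∀ v : Fin r → Kˣ,
      (((e.symm v : T) : GL (Fin n) K) : Matrix (Fin n) (Fin n) K) i j =
        eval (Sum.elim (fun k => ((v k : Kˣ) : K)) (fun k => (((v k)⁻¹ : Kˣ) : K))) p)

/-- The reductive rank of `G` is `r`: some maximal torus of `G` has rank `r`. -/
def HasRedRank {n : ℕ} (G : Subgroup (GL (Fin n) K)) (r : ℕ) : Prop :=
  ∃ T : Subgroup (GL (Fin n) K), IsMaximalTorus G T ∧ TorusHasRank T r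

/-- Polynomials in the entries of a matrix and in the entries of its inverse. -/
abbrev MatPoly (n : ℕ) (K : Type) [Field K] : Type :=
  MvPolynomial ((Fin n × Fin n) ⊕ (Fin n × Fin n)) K

namespace MatPoly

variable {n : ℕ}

/-- The `i`-th entry of `A *ᵥ w`, as a polynomial in `A`. -/
noncomputable def mulVecPoly (i : Fin n) : (Fin n → K) →ₗ[K] MatPoly n K :=
  ∑ k, (LinearMap.proj k).smulRight (X (Sum.inl (i, k)))

/-- The `j`-th entry of `w ᵥ* A⁻¹`, as a polynomial in the entries of `A⁻¹`. -/
noncomputable def vecMulPoly (j : Fin n) : (Fin n → K) →ₗ[K] MatPoly n K :=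
  ∑ k, (LinearMap.proj k).smulRight (X (Sum.inr (k, j)))

lemma mulVecPoly_apply (i : Fin n) (w : Fin n → K) :
    mulVecPoly i w = ∑ k, w k • (X (Sum.inl (i, k)) : MatPoly n K) := by
  simp [mulVecPoly]

lemma vecMulPoly_apply (j : Fin n) (w : Fin n → K) :
    vecMulPoly j w = ∑ k, w k • (X (Sum.inr (k, j)) : MatPoly n K) := by
  simp [vecMulPoly]

lemma mulVecPoly_single (i k : Fin n) :
    mulVecPoly i (Pi.single k (1 : K)) = X (Sum.inl (i, k)) := by
  simp [mulVecPoly_apply, Pi.single_apply]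

lemma vecMulPoly_single (j k : Fin n) :
    vecMulPoly j (Pi.single k (1 : K)) = X (Sum.inr (k, j)) := by
  simp [vecMulPoly_apply, Pi.single_apply]

lemma eval_mulVecPoly (A : GL (Fin n) K) (i : Fin n) (w : Fin n → K) :
    eval (matOf A) (mulVecPoly i w) = ((A : Matrix (Fin n) (Fin n) K) *ᵥ w) i := by
  simp [mulVecPoly_apply, matOf, mulVec, dotProduct, mul_comm, smul_eval]

lemma eval_vecMulPoly (A : GL (Fin n) K) (j : Fin n) (w : Fin n → K) :
    eval (matOf A) (vecMulPoly j w) =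
      (w ᵥ* ((A⁻¹ : GL (Fin n) K) : Matrix (Fin n) (Fin n) K)) j := by
  simp [vecMulPoly_apply, matOf, vecMul, dotProduct, smul_eval]

/-- Right translation by `g` on polynomial functions. -/
noncomputable def rightTranslate (g : GL (Fin n) K) : MatPoly n K →ₐ[K] MatPoly n K :=
  aeval (Sum.elim (fun q => mulVecPoly q.1 (fun k => (g : Matrix (Fin n) (Fin n) K) k q.2))
    (fun q => vecMulPoly q.2
      (fun k => ((g⁻¹ : GL (Fin n) K) : Matrix (Fin n) (Fin n) K) q.1 k)))

/-- Left translation by `g` on polynomial functions. -/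
noncomputable def leftTranslate (g : GL (Fin n) K) : MatPoly n K →ₐ[K] MatPoly n K :=
  aeval (Sum.elim
    (fun q => ∑ k, (g : Matrix (Fin n) (Fin n) K) q.1 k • X (Sum.inl (k, q.2)))
    (fun q => ∑ k, ((g⁻¹ : GL (Fin n) K) : Matrix (Fin n) (Fin n) K) k q.2 •
      X (Sum.inr (q.1, k))))

/-- The left-invariant derivation on polynomial functions attached to a matrix. -/
noncomputable def lieDeriv (Z : Matrix (Fin n) (Fin n) K) :
    Derivation K (MatPoly n K) (MatPoly n K) :=
  mkDerivation K (Sum.elim (fun q => mulVecPoly q.1 (fun k => Z k q.2))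
    (fun q => - vecMulPoly q.2 (fun k => Z q.1 k)))

lemma eval_rightTranslate (A g : GL (Fin n) K) (p : MatPoly n K) :
    eval (matOf A) (rightTranslate g p) = eval (matOf (A * g)) p := by
  have h : (aeval (matOf A)).comp (rightTranslate g) =
      (aeval (matOf (A * g)) : MatPoly n K →ₐ[K] K) := by
    ext q
    rcases q with q | q
    · simp only [AlgHom.comp_apply, rightTranslate, aeval_X, Sum.elim_inl]
      exact eval_mulVecPoly A q.1 _
    · simp only [AlgHom.comp_apply, rightTranslate, aeval_X, Sum.elim_inr]
      refine (eval_vecMulPoly A q.2 _).trans ?_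
      simp only [matOf, _root_.mul_inv_rev, Sum.elim_inr]
      rfl
  simpa [coe_aeval_eq_eval] using DFunLike.congr_fun h p

lemma eval_leftTranslate (A g : GL (Fin n) K) (p : MatPoly n K) :
    eval (matOf A) (leftTranslate g p) = eval (matOf (g * A)) p := by
  have h : (aeval (matOf A)).comp (leftTranslate g) =
      (aeval (matOf (g * A)) : MatPoly n K →ₐ[K] K) := by
    ext q
    rcases q with q | q
    · simp [leftTranslate, matOf, Matrix.mul_apply]
    · simp [leftTranslate, matOf, Matrix.mul_apply, -coe_units_inv, mul_comm]
  simpa [coe_aeval_eq_eval] using DFunLike.congr_fun h p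

lemma rightTranslate_mulVecPoly (g : GL (Fin n) K) (i : Fin n) (w : Fin n → K) :
    rightTranslate g (mulVecPoly i w) =
      mulVecPoly i ((g : Matrix (Fin n) (Fin n) K) *ᵥ w) := by
  simp only [mulVecPoly_apply, map_sum, map_smul, rightTranslate, aeval_X, Sum.elim_inl,
    mulVec, dotProduct, Finset.sum_smul, Finset.smul_sum, smul_smul]
  rw [Finset.sum_comm]
  simp only [mul_comm]

lemma rightTranslate_vecMulPoly (g : GL (Fin n) K) (j : Fin n) (w : Fin n → K) :
    rightTranslate g (vecMulPoly j w) =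
      vecMulPoly j (w ᵥ* ((g⁻¹ : GL (Fin n) K) : Matrix (Fin n) (Fin n) K)) := by
  simp only [vecMulPoly_apply, map_sum, map_smul, rightTranslate, aeval_X, Sum.elim_inr,
    vecMul, dotProduct, Finset.sum_smul, Finset.smul_sum, smul_smul]
  rw [Finset.sum_comm]

lemma lieDeriv_mulVecPoly (Z : Matrix (Fin n) (Fin n) K) (i : Fin n) (w : Fin n → K) :
    lieDeriv Z (mulVecPoly i w) = mulVecPoly i (Z *ᵥ w) := by
  simp only [mulVecPoly_apply, map_sum, Derivation.map_smul, lieDeriv, mkDerivation_X, Sum.elim_inl,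
    mulVec, dotProduct, Finset.sum_smul, Finset.smul_sum, smul_smul]
  rw [Finset.sum_comm]
  simp only [mul_comm]

lemma lieDeriv_vecMulPoly (Z : Matrix (Fin n) (Fin n) K) (j : Fin n) (w : Fin n → K) :
    lieDeriv Z (vecMulPoly j w) = - vecMulPoly j (w ᵥ* Z) := by
  simp only [vecMulPoly_apply, map_sum, Derivation.map_smul, lieDeriv, mkDerivation_X, Sum.elim_inr,
    vecMul, dotProduct, Finset.sum_smul, Finset.smul_sum, smul_smul, smul_neg,
    Finset.sum_neg_distrib]
  rw [Finset.sum_comm]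

lemma lieDeriv_X_inl (Z : Matrix (Fin n) (Fin n) K) (q : Fin n × Fin n) :
    lieDeriv Z (X (Sum.inl q)) = mulVecPoly q.1 (Z *ᵥ Pi.single q.2 1) := by
  rw [← mulVecPoly_single, lieDeriv_mulVecPoly]

lemma lieDeriv_X_inr (Z : Matrix (Fin n) (Fin n) K) (q : Fin n × Fin n) :
    lieDeriv Z (X (Sum.inr q)) = - vecMulPoly q.2 (Pi.single q.1 1 ᵥ* Z) := by
  rw [← vecMulPoly_single, lieDeriv_vecMulPoly]

lemma lieDeriv_add (Y Z : Matrix (Fin n) (Fin n) K) :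
    lieDeriv (Y + Z) = lieDeriv Y + lieDeriv Z := by
  ext q : 1
  rcases q with q | q
  · simp only [Derivation.add_apply, lieDeriv_X_inl, add_mulVec, map_add]
  · simp only [Derivation.add_apply, lieDeriv_X_inr, vecMul_add, map_add]
    abel

lemma lieDeriv_smul (c : K) (Z : Matrix (Fin n) (Fin n) K) :
    lieDeriv (c • Z) = c • lieDeriv Z := by
  ext q : 1
  rcases q with q | q
  · simp only [Derivation.smul_apply, lieDeriv_X_inl, smul_mulVec, map_smul]
  · simp only [Derivation.smul_apply, lieDeriv_X_inr, vecMul_smul, map_smul, smul_neg]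

/-- `lieDeriv` as a linear map in the matrix. -/
noncomputable def lieDerivₗ :
    Matrix (Fin n) (Fin n) K →ₗ[K] Derivation K (MatPoly n K) (MatPoly n K) where
  toFun := lieDeriv
  map_add' := lieDeriv_add
  map_smul' := lieDeriv_smul

lemma lieDeriv_lie (Y Z : Matrix (Fin n) (Fin n) K) :
    lieDeriv ⁅Y, Z⁆ = ⁅lieDeriv Y, lieDeriv Z⁆ := by
  ext q : 1
  rcases q with q | q
  · simp only [Derivation.commutator_apply, lieDeriv_X_inl, lieDeriv_mulVecPoly, Ring.lie_def,
      sub_mulVec, map_sub, mulVec_mulVec]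
  · simp only [Derivation.commutator_apply, lieDeriv_X_inr, lieDeriv_vecMulPoly, Ring.lie_def,
      vecMul_sub, map_sub, vecMul_vecMul, map_neg]
    abel

lemma rightTranslate_lieDeriv (g : GL (Fin n) K) (Z : Matrix (Fin n) (Fin n) K)
    (p : MatPoly n K) :
    rightTranslate g (lieDeriv Z p) =
      lieDeriv ((g : Matrix (Fin n) (Fin n) K) * Z *
        ((g⁻¹ : GL (Fin n) K) : Matrix (Fin n) (Fin n) K)) (rightTranslate g p) := by
  induction p using MvPolynomial.induction_on with
  | C a => simp [rightTranslate, algHom_C]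
  | add p q hp hq => simp only [map_add, hp, hq]
  | mul_X p q hp =>
    have key : rightTranslate g (lieDeriv Z (X q)) =
        lieDeriv ((g : Matrix (Fin n) (Fin n) K) * Z *
          ((g⁻¹ : GL (Fin n) K) : Matrix (Fin n) (Fin n) K)) (rightTranslate g (X q)) := by
      rcases q with q | q
      · rw [lieDeriv_X_inl, ← Prod.mk.eta (p := q), ← mulVecPoly_single]
        simp only [rightTranslate_mulVecPoly, lieDeriv_mulVecPoly, mulVec_mulVec]
        simp [mul_assoc, -coe_units_inv]
      · rw [lieDeriv_X_inr, ← Prod.mk.eta (p := q), ← vecMulPoly_single]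
        simp only [rightTranslate_vecMulPoly, lieDeriv_vecMulPoly, vecMul_vecMul, map_neg]
        simp [← mul_assoc, -coe_units_inv]
    simp only [Derivation.leibniz, map_mul, map_add, smul_eq_mul, hp, key]

lemma leftTranslate_lieDeriv (g : GL (Fin n) K) (Z : Matrix (Fin n) (Fin n) K)
    (p : MatPoly n K) :
    leftTranslate g (lieDeriv Z p) = lieDeriv Z (leftTranslate g p) := by
  induction p using MvPolynomial.induction_on with
  | C a => simp [leftTranslate, algHom_C]
  | add p q hp hq => simp only [map_add, hp, hq]
  | mul_X p q hp =>
    have key : leftTranslate g (lieDeriv Z (X q)) = lieDeriv Z (leftTranslate g (X q)) := by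
      rcases q with q | q
      · simp only [lieDeriv_X_inl, mulVecPoly_apply, map_sum, map_smul, leftTranslate, aeval_X,
          Sum.elim_inl, Finset.smul_sum, Derivation.map_smul]
        rw [Finset.sum_comm]
        simp only [smul_smul, mul_comm]
      · simp only [lieDeriv_X_inr, vecMulPoly_apply, map_sum, map_smul, leftTranslate, aeval_X,
          Sum.elim_inr, Finset.smul_sum, map_neg, smul_neg, Finset.sum_neg_distrib,
          Derivation.map_smul]
        rw [Finset.sum_comm]
        simp only [smul_smul, mul_comm]
    simp only [Derivation.leibniz, map_mul, map_add, smul_eq_mul, hp, key]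

end MatPoly

section EigenspaceDecomposition

open Module.End

variable {V W : Type*} [AddCommGroup V] [Module K V] [AddCommGroup W] [Module K W]

lemma map_mem_maxGenEigenspace (L : V →ₗ[K] W) (f : Module.End K V) (g : Module.End K W)
    (h : ∀ v, L (f v) = g (L v)) {μ : K} {v : V} (hv : v ∈ f.maxGenEigenspace μ) :
    L v ∈ g.maxGenEigenspace μ := by
  rw [mem_maxGenEigenspace] at hv ⊢
  obtain ⟨k, hk⟩ := hv
  refine ⟨k, ?_⟩
  have hcomm : ∀ k : ℕ, ∀ v, L (((f - μ • (1 : Module.End K V)) ^ k) v) =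
      ((g - μ • (1 : Module.End K W)) ^ k) (L v) := by
    intro k
    induction k with
    | zero => simp
    | succ k ih =>
      intro v
      rw [pow_succ, pow_succ, Module.End.mul_apply, Module.End.mul_apply, ih]
      simp [h]
  rw [← hcomm, hk, map_zero]

/-- If a sum of generalized eigenvectors for distinct eigenvalues lies in an invariant subspace,
so does each summand. -/
lemma component_mem_of_sum_mem {Φ : Module.End K V} {I : Submodule K V}
    (hI : ∀ p ∈ I, Φ p ∈ I) {M : Type*} {χ : M → K} (hχ : Function.Injective χ)
    {E : M → Submodule K V} (hE : ∀ v, E v ≤ Φ.maxGenEigenspace (χ v)) (S : Finset M)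
    (p : M → V) (hp : ∀ v ∈ S, p v ∈ E v) (hs : ∑ v ∈ S, p v ∈ I) : ∀ v ∈ S, p v ∈ I := by
  have hind := (Module.End.independent_maxGenEigenspace (I.mapQ I Φ hI)).comp hχ
  rw [iSupIndep_iff_finsetSum_eq_zero_imp_eq_zero] at hind
  intro v hv
  rw [← Submodule.Quotient.mk_eq_zero]
  refine hind S (fun v => I.mkQ (p v)) ?_ ?_ v hv
  · intro v hv
    exact map_mem_maxGenEigenspace I.mkQ Φ _ (fun _ => rfl) (hE v (hp v hv))
  · rw [← map_sum]
    exact (Submodule.Quotient.mk_eq_zero I).2 hs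

lemma scalar_on_components_mem {Φ : Module.End K V} {I : Submodule K V}
    (hI : ∀ p ∈ I, Φ p ∈ I) {M : Type*} {χ : M → K} (hχ : Function.Injective χ)
    {E : M → Submodule K V} (hE : ∀ v, E v ≤ Φ.maxGenEigenspace (χ v)) (htop : ⨆ v, E v = ⊤)
    {Ψ : V →ₗ[K] V} {ψ : M → K} (hΨ : ∀ v, ∀ p ∈ E v, Ψ p = ψ v • p) {p : V} (hp : p ∈ I) :
    Ψ p ∈ I := by
  obtain ⟨f, hf, rfl⟩ := (Submodule.mem_iSup_iff_exists_finsupp E p).1 (htop ▸ Submodule.mem_top)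
  rw [Finsupp.sum, map_sum]
  refine Submodule.sum_mem _ fun v hv => ?_
  rw [hΨ v _ (hf v)]
  exact I.smul_mem _ (component_mem_of_sum_mem hI hχ hE f.support f (fun v _ => hf v) hp v hv)

lemma mem_of_apply_sub_mem {Φ : Module.End K V} {I : Submodule K V}
    (hI : ∀ p ∈ I, Φ p ∈ I) {M : Type*} {χ : M → K} (hχ : Function.Injective χ)
    {E : M → Submodule K V} (hE : ∀ v, E v ≤ Φ.maxGenEigenspace (χ v)) (htop : ⨆ v, E v = ⊤)
    {Ψ : V →ₗ[K] V} {ψ : M → K} (hΨ : ∀ v, ∀ p ∈ E v, Ψ p = ψ v • p)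
    {v₀ : M} (h₀ : ψ v₀ = 0) {e : V} (he : e ∈ E v₀) {p : V} (hp : Ψ p - e ∈ I) : e ∈ I := by
  classical
  obtain ⟨f, hf, rfl⟩ := (Submodule.mem_iSup_iff_exists_finsupp E p).1 (htop ▸ Submodule.mem_top)
  have hsum : Ψ (f.sum fun _ x => x) - e =
      ∑ v ∈ insert v₀ f.support, (ψ v • f v - if v = v₀ then e else 0) := by
    rw [Finset.sum_sub_distrib, Finset.sum_ite_eq' _ v₀, if_pos (Finset.mem_insert_self _ _),
      Finsupp.sum, map_sum, ← Finset.sum_subset (Finset.subset_insert v₀ f.support)]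
    · exact congrArg (· - e) (Finset.sum_congr rfl fun v _ => hΨ v _ (hf v))
    · intro v _ hv
      rw [Finsupp.notMem_support_iff.1 hv, smul_zero]
  rw [hsum] at hp
  have := component_mem_of_sum_mem hI hχ hE _ _ (fun v _ => ?_) hp v₀ (Finset.mem_insert_self _ _)
  · simpa [h₀] using this
  · refine Submodule.sub_mem _ (Submodule.smul_mem _ _ (hf v)) ?_
    split_ifs with h
    · exact h ▸ he
    · exact Submodule.zero_mem _

end EigenspaceDecomposition

section GeneralizedEigenvectorProducts

open Module.End

variable {P : Type*} [CommRing P] [Algebra K P]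

lemma Derivation.mul_mem_maxGenEigenspace (D : Derivation K P P) {μ ν : K} {p q : P}
    (hp : p ∈ Module.End.maxGenEigenspace (D : P →ₗ[K] P) μ)
    (hq : q ∈ Module.End.maxGenEigenspace (D : P →ₗ[K] P) ν) :
    p * q ∈ Module.End.maxGenEigenspace (D : P →ₗ[K] P) (μ + ν) := by
  rw [mem_maxGenEigenspace] at *
  obtain ⟨a, ha⟩ := hp
  obtain ⟨b, hb⟩ := hq
  have key : ∀ k a b : ℕ, a + b = k → ∀ p q : P,
      (((D : P →ₗ[K] P) - μ • (1 : Module.End K P)) ^ a) p = 0 →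
      (((D : P →ₗ[K] P) - ν • (1 : Module.End K P)) ^ b) q = 0 →
      (((D : P →ₗ[K] P) - (μ + ν) • (1 : Module.End K P)) ^ k) (p * q) = 0 := by
    intro k
    induction k with
    | zero =>
      intro a b hab p q hp hq
      obtain rfl : a = 0 := by omega
      simp_all
    | succ k ih =>
      intro a b hab p q hp hq
      have hstep : ((D : P →ₗ[K] P) - (μ + ν) • (1 : Module.End K P)) (p * q) =
          ((D : P →ₗ[K] P) - μ • (1 : Module.End K P)) p * q +
            p * ((D : P →ₗ[K] P) - ν • (1 : Module.End K P)) q := by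
        simp only [LinearMap.sub_apply, LinearMap.smul_apply, Module.End.one_apply,
          Derivation.coeFn_coe, Derivation.leibniz, smul_eq_mul]
        simp only [Algebra.smul_def, map_add]
        ring
      rw [pow_succ, Module.End.mul_apply, hstep, map_add]
      rcases a with _ | a
      · obtain rfl : p = 0 := by simpa using hp
        simp
      rcases b with _ | b
      · obtain rfl : q = 0 := by simpa using hq
        simp
      rw [ih a (b + 1) (by omega) _ _ (by rwa [pow_succ, Module.End.mul_apply] at hp) hq,
        ih (a + 1) b (by omega) _ _ hp (by rwa [pow_succ, Module.End.mul_apply] at hq), add_zero]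
  exact ⟨a + b, key _ a b rfl p q ha hb⟩

lemma AlgHom.mul_mem_maxGenEigenspace (R : P →ₐ[K] P) {μ ν : K} {p q : P}
    (hp : p ∈ Module.End.maxGenEigenspace R.toLinearMap μ)
    (hq : q ∈ Module.End.maxGenEigenspace R.toLinearMap ν) :
    p * q ∈ Module.End.maxGenEigenspace R.toLinearMap (μ * ν) := by
  rw [mem_maxGenEigenspace] at *
  obtain ⟨a, ha⟩ := hp
  obtain ⟨b, hb⟩ := hq
  have key : ∀ k a b : ℕ, a + b = k → ∀ p q : P,
      ((R.toLinearMap - μ • (1 : Module.End K P)) ^ a) p = 0 →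
      ((R.toLinearMap - ν • (1 : Module.End K P)) ^ b) q = 0 →
      ((R.toLinearMap - (μ * ν) • (1 : Module.End K P)) ^ k) (p * q) = 0 := by
    intro k
    induction k with
    | zero =>
      intro a b hab p q hp hq
      obtain rfl : a = 0 := by omega
      simp_all
    | succ k ih =>
      intro a b hab p q hp hq
      have hstep : (R.toLinearMap - (μ * ν) • (1 : Module.End K P)) (p * q) =
          (R.toLinearMap - μ • (1 : Module.End K P)) p * R q +
            (μ • p) * (R.toLinearMap - ν • (1 : Module.End K P)) q := by
        simp only [LinearMap.sub_apply, LinearMap.smul_apply, Module.End.one_apply,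
          AlgHom.toLinearMap_apply, map_mul]
        simp only [Algebra.smul_def, map_mul]
        ring
      rw [pow_succ, Module.End.mul_apply, hstep, map_add]
      rcases a with _ | a
      · obtain rfl : p = 0 := by simpa using hp
        simp
      rcases b with _ | b
      · obtain rfl : q = 0 := by simpa using hq
        simp
      have hRq : ((R.toLinearMap - ν • (1 : Module.End K P)) ^ (b + 1)) (R q) = 0 := by
        have hc : Commute ((R.toLinearMap - ν • (1 : Module.End K P)) ^ (b + 1))
            (R.toLinearMap : Module.End K P) :=
          ((Commute.refl _).sub_left ((Commute.one_left _).smul_left ν)).pow_left _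
        have := LinearMap.congr_fun hc.eq q
        simp only [Module.End.mul_apply, AlgHom.toLinearMap_apply] at this
        rw [this, hq, map_zero]
      have hμp : ((R.toLinearMap - μ • (1 : Module.End K P)) ^ (a + 1)) (μ • p) = 0 := by
        rw [map_smul, hp, smul_zero]
      rw [ih a (b + 1) (by omega) _ _ (by rwa [pow_succ, Module.End.mul_apply] at hp) hRq,
        ih (a + 1) b (by omega) _ _ hμp (by rwa [pow_succ, Module.End.mul_apply] at hq), add_zero]
  exact ⟨a + b, key _ a b rfl p q ha hb⟩

end GeneralizedEigenvectorProducts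

namespace MatPoly

variable {n : ℕ}

/-- A family of subspaces indexed by weights, compatible with products and containing the linear
forms attached to a basis of weight vectors, spans all polynomial functions. -/
lemma iSup_weight_eq_top {M : Type*} [AddCommGroup M] (E : M → Submodule K (MatPoly n K))
    (h1 : 1 ∈ E 0) (hmul : ∀ v w, ∀ p ∈ E v, ∀ q ∈ E w, p * q ∈ E (v + w))
    (g : GL (Fin n) K) (a : Fin n → M)
    (hcol : ∀ i k, mulVecPoly i ((g : Matrix (Fin n) (Fin n) K) *ᵥ Pi.single k 1) ∈ E (a k))
    (hrow : ∀ j k, vecMulPoly j (Pi.single k 1 ᵥ*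
      ((g⁻¹ : GL (Fin n) K) : Matrix (Fin n) (Fin n) K)) ∈ E (-a k)) :
    ⨆ v, E v = ⊤ := by
  have hle : ∀ v, E v ≤ ⨆ v, E v := le_iSup E
  have hX : ∀ q, (X q : MatPoly n K) ∈ ⨆ v, E v := by
    rintro (⟨i, k⟩ | ⟨k, j⟩)
    · have : (Pi.single k 1 : Fin n → K) = ∑ l,
          (((g⁻¹ : GL (Fin n) K) : Matrix (Fin n) (Fin n) K) *ᵥ Pi.single k 1) l •
            ((g : Matrix (Fin n) (Fin n) K) *ᵥ Pi.single l 1) := by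
        simp_rw [← mulVec_smul]
        rw [← mulVec_sum, ← pi_eq_sum_univ', mulVec_mulVec, ← Units.val_mul, mul_inv_cancel,
          Units.val_one, one_mulVec]
      rw [← mulVecPoly_single, this, map_sum]
      refine Submodule.sum_mem _ fun l _ => ?_
      rw [map_smul]
      exact Submodule.smul_mem _ _ (hle _ (hcol i l))
    · have : (Pi.single k 1 : Fin n → K) = ∑ l,
          (Pi.single k 1 ᵥ* (g : Matrix (Fin n) (Fin n) K)) l •
            (Pi.single l 1 ᵥ* ((g⁻¹ : GL (Fin n) K) : Matrix (Fin n) (Fin n) K)) := by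
        simp_rw [← smul_vecMul]
        rw [← sum_vecMul, ← pi_eq_sum_univ', vecMul_vecMul, ← Units.val_mul, mul_inv_cancel,
          Units.val_one, vecMul_one]
      rw [← vecMulPoly_single, this, map_sum]
      refine Submodule.sum_mem _ fun l _ => ?_
      rw [map_smul]
      exact Submodule.smul_mem _ _ (hle _ (hrow j l))
  have hmul' : ∀ p ∈ ⨆ v, E v, ∀ q ∈ ⨆ v, E v, p * q ∈ ⨆ v, E v := by
    intro p hp q hq
    have hle' : (⨆ v, E v) * (⨆ v, E v) ≤ ⨆ v, E v := by
      simp only [Submodule.iSup_mul, Submodule.mul_iSup]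
      refine iSup_le fun v => iSup_le fun w => ?_
      rw [Submodule.mul_le]
      exact fun p hp q hq => hle _ (hmul _ _ p hp q hq)
    exact hle' (Submodule.mul_mem_mul hp hq)
  rw [eq_top_iff]
  rintro p -
  induction p using MvPolynomial.induction_on with
  | C a =>
    rw [← mul_one (C a), ← smul_eq_C_mul]
    exact Submodule.smul_mem _ _ (hle _ h1)
  | add p q hp hq => exact Submodule.add_mem _ hp hq
  | mul_X p q hp => exact hmul' _ hp _ (hX q)

end MatPoly

section ConjDiag

open Module.End

variable {n : ℕ}

/-- The matrix that acts on the `k`-th column of `g` as the scalar `d k`. -/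
def conjDiag (g : GL (Fin n) K) (d : Fin n → K) : Matrix (Fin n) (Fin n) K :=
  (g : Matrix (Fin n) (Fin n) K) * diagonal d * ((g⁻¹ : GL (Fin n) K) : Matrix (Fin n) (Fin n) K)

lemma GL_val_mul_val_inv (g : GL (Fin n) K) : (g : Matrix (Fin n) (Fin n) K) *
    ((g⁻¹ : GL (Fin n) K) : Matrix (Fin n) (Fin n) K) = 1 := Units.mul_inv g

lemma GL_val_inv_mul_val (g : GL (Fin n) K) : ((g⁻¹ : GL (Fin n) K) : Matrix (Fin n) (Fin n) K) *
    (g : Matrix (Fin n) (Fin n) K) = 1 := Units.inv_mul g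

lemma conjDiag_mul (g : GL (Fin n) K) (d d' : Fin n → K) :
    conjDiag g d * conjDiag g d' = conjDiag g (d * d') := by
  have : (d * d') = fun i => d i * d' i := rfl
  rw [conjDiag, conjDiag, conjDiag, this, ← diagonal_mul_diagonal]
  simp only [mul_assoc]
  rw [← mul_assoc _ (g : Matrix (Fin n) (Fin n) K), GL_val_inv_mul_val, one_mul]

lemma conjDiag_one (g : GL (Fin n) K) : conjDiag g 1 = 1 := by
  rw [conjDiag, show diagonal (1 : Fin n → K) = 1 from diagonal_one, mul_one, GL_val_mul_val_inv]

lemma conjDiag_sum_smul {ι : Type*} (s : Finset ι) (g : GL (Fin n) K) (c : ι → K)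
    (d : ι → Fin n → K) :
    conjDiag g (∑ i ∈ s, c i • d i) = ∑ i ∈ s, c i • conjDiag g (d i) := by
  have : diagonal (∑ i ∈ s, c i • d i) = ∑ i ∈ s, c i • diagonal (d i) := by
    have h := map_sum (diagonalLinearMap (Fin n) K K) (fun i => c i • d i) s
    simp only [map_smul] at h
    exact h
  rw [conjDiag, this, Finset.mul_sum, Finset.sum_mul]
  simp [conjDiag]

lemma trace_conjDiag (g : GL (Fin n) K) (d : Fin n → K) : (conjDiag g d).trace = ∑ k, d k := by
  rw [conjDiag, trace_mul_comm, ← mul_assoc, GL_val_inv_mul_val, one_mul, trace_diagonal]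

lemma conjDiag_mulVec_single (g : GL (Fin n) K) (d : Fin n → K) (k : Fin n) :
    conjDiag g d *ᵥ ((g : Matrix (Fin n) (Fin n) K) *ᵥ Pi.single k 1) =
      d k • ((g : Matrix (Fin n) (Fin n) K) *ᵥ Pi.single k 1) := by
  rw [mulVec_mulVec, conjDiag, mul_assoc, GL_val_inv_mul_val, mul_one, ← mulVec_mulVec,
    ← mulVec_smul]
  congr 1
  ext i
  simp [Pi.single_apply]

lemma single_vecMul_conjDiag (g : GL (Fin n) K) (d : Fin n → K) (k : Fin n) :
    (Pi.single k 1 ᵥ* ((g⁻¹ : GL (Fin n) K) : Matrix (Fin n) (Fin n) K)) ᵥ* conjDiag g d =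
      d k • (Pi.single k 1 ᵥ* ((g⁻¹ : GL (Fin n) K) : Matrix (Fin n) (Fin n) K)) := by
  rw [vecMul_vecMul, conjDiag, ← mul_assoc, ← mul_assoc, GL_val_inv_mul_val, one_mul,
    ← vecMul_vecMul, ← smul_vecMul]
  congr 1
  ext i
  by_cases h : k = i <;> simp [h, eq_comm]

/-- An invertible conjugate of a diagonal matrix. -/
noncomputable def conjDiagGL (g : GL (Fin n) K) (d : Fin n → Kˣ) : GL (Fin n) K where
  val := conjDiag g (fun k => (d k : K))
  inv := conjDiag g (fun k => ((d k)⁻¹ : Kˣ))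
  val_inv := by
    rw [conjDiag_mul, ← conjDiag_one g]
    congr 1
    ext k
    simp
  inv_val := by
    rw [conjDiag_mul, ← conjDiag_one g]
    congr 1
    ext k
    simp

lemma conjDiagGL_val (g : GL (Fin n) K) (d : Fin n → Kˣ) :
    (conjDiagGL g d : Matrix (Fin n) (Fin n) K) = conjDiag g (fun k => (d k : K)) := rfl

lemma conjDiagGL_inv_val (g : GL (Fin n) K) (d : Fin n → Kˣ) :
    ((conjDiagGL g d)⁻¹ : GL (Fin n) K).val = conjDiag g (fun k => ((d k)⁻¹ : Kˣ)) := rfl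

lemma Commute.conjDiag_of_imp {Z : Matrix (Fin n) (Fin n) K} {g : GL (Fin n) K} {d d' : Fin n → K}
    (h : Commute Z (conjDiag g d)) (hd : ∀ j k, d j = d k → d' j = d' k) :
    Commute Z (conjDiag g d') := by
  set gm := (g : Matrix (Fin n) (Fin n) K)
  set gi := ((g⁻¹ : GL (Fin n) K) : Matrix (Fin n) (Fin n) K)
  have h1 : gm * gi = 1 := GL_val_mul_val_inv g
  have h2 : gi * gm = 1 := GL_val_inv_mul_val g
  have key : ∀ e : Fin n → K, Commute Z (conjDiag g e) ↔ Commute (gi * Z * gm) (diagonal e) := by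
    intro e
    constructor
    · intro h
      have := congrArg (fun A => gi * A * gm) h.eq
      simp only [conjDiag] at this
      change gi * (Z * (gm * diagonal e * gi)) * gm = gi * ((gm * diagonal e * gi) * Z) * gm at this
      calc gi * Z * gm * diagonal e = gi * (Z * (gm * diagonal e * gi)) * gm := by
            simp only [mul_assoc, h2, mul_one]
        _ = (gi * gm) * diagonal e * (gi * Z * gm) := by rw [this]; simp only [mul_assoc]
        _ = _ := by rw [h2, one_mul]
    · intro h
      have := congrArg (fun A => gm * A * gi) h.eq
      change gm * (gi * Z * gm * diagonal e) * gi = gm * (diagonal e * (gi * Z * gm)) * gi at this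
      change Z * (gm * diagonal e * gi) = gm * diagonal e * gi * Z
      calc Z * (gm * diagonal e * gi) = (gm * gi) * Z * (gm * diagonal e * gi) := by
            rw [h1, one_mul]
        _ = gm * (gi * Z * gm * diagonal e) * gi := by simp only [mul_assoc]
        _ = gm * (diagonal e * (gi * Z * gm)) * gi := this
        _ = gm * diagonal e * gi * Z := by simp only [mul_assoc, h1, mul_one]
  rw [key] at h ⊢
  ext j k
  have hjk := congrFun (congrFun h.eq j) k
  simp only [mul_diagonal, diagonal_mul] at hjk ⊢
  by_cases hz : (gi * Z * gm) j k = 0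
  · simp [hz]
  · rw [mul_comm] at hjk
    rw [hd j k (mul_right_cancel₀ hz hjk).symm, mul_comm]

lemma exists_GL_of_span_eq_top {S : Set (Fin n → K)} (hS : Submodule.span K S = ⊤) :
    ∃ g : GL (Fin n) K, ∀ k, (g : Matrix (Fin n) (Fin n) K) *ᵥ Pi.single k 1 ∈ S := by
  let b₀ := Module.Basis.ofSpan hS.ge
  have := Module.Finite.finite_basis b₀
  have := Fintype.ofFinite ((linearIndepOn_empty K id).extend (Set.empty_subset S))
  have hcard := Module.finrank_eq_card_basis b₀
  rw [Module.finrank_fin_fun] at hcard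
  let b := b₀.reindex (Fintype.equivFinOfCardEq hcard.symm)
  refine ⟨⟨LinearMap.toMatrix' b.equivFun.symm.toLinearMap,
    LinearMap.toMatrix' b.equivFun.toLinearMap, ?_, ?_⟩, fun k => ?_⟩
  · rw [← LinearMap.toMatrix'_comp]
    simp
  · rw [← LinearMap.toMatrix'_comp]
    simp
  · change LinearMap.toMatrix' b.equivFun.symm.toLinearMap *ᵥ Pi.single k 1 ∈ S
    rw [LinearMap.toMatrix'_mulVec, LinearEquiv.coe_coe, ← Pi.basisFun_apply,
      Module.Basis.equivFun_symm_apply]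
    simp only [Pi.basisFun_apply, Pi.single_apply, ite_smul, one_smul, zero_smul,
      Finset.sum_ite_eq', Finset.mem_univ, if_true]
    rw [Module.Basis.reindex_apply]
    exact Module.Basis.ofSpan_subset hS.ge ⟨_, rfl⟩

lemma eq_conjDiag_of_mulVec {A : Matrix (Fin n) (Fin n) K} {g : GL (Fin n) K} {d : Fin n → K}
    (h : ∀ k, A *ᵥ ((g : Matrix (Fin n) (Fin n) K) *ᵥ Pi.single k 1) =
      d k • ((g : Matrix (Fin n) (Fin n) K) *ᵥ Pi.single k 1)) : A = conjDiag g d := by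
  have : A * (g : Matrix (Fin n) (Fin n) K) = conjDiag g d * (g : Matrix (Fin n) (Fin n) K) := by
    ext i k
    have := congrFun ((h k).trans (conjDiag_mulVec_single g d k).symm) i
    rw [mulVec_mulVec, mulVec_mulVec, mulVec_single_one, mulVec_single_one] at this
    exact this
  calc A = A * (g : Matrix (Fin n) (Fin n) K) * (g⁻¹ : GL (Fin n) K).val := by
        rw [mul_assoc, GL_val_mul_val_inv, mul_one]
    _ = _ := by rw [this, mul_assoc, GL_val_mul_val_inv, mul_one]

/-- Additive Jordan decomposition of a matrix. -/
lemma exists_conjDiag_add_nilpotent [IsAlgClosed K] (Y : Matrix (Fin n) (Fin n) K) :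
    ∃ (g : GL (Fin n) K) (d : Fin n → K) (m : Matrix (Fin n) (Fin n) K),
      Y = conjDiag g d + m ∧ IsNilpotent m ∧ ∀ Z, Commute Z Y → Commute Z (conjDiag g d) := by
  obtain ⟨m, -, s, hs, hm, hss, hY⟩ := exists_isNilpotent_isSemisimple (f := toLinAlgEquiv' Y)
  have htop := iSup_maxGenEigenspace_eq_top s
  simp_rw [hss.isFinitelySemisimple.maxGenEigenspace_eq_eigenspace] at htop
  obtain ⟨g, hg⟩ := exists_GL_of_span_eq_top (S := ⋃ μ, (s.eigenspace μ : Set (Fin n → K)))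
    (by rw [Submodule.span_iUnion]; simpa using htop)
  choose d hd using fun k => Set.mem_iUnion.1 (hg k)
  have hsd : (toLinAlgEquiv' (R := K) (n := Fin n)).symm s = conjDiag g d := by
    apply eq_conjDiag_of_mulVec
    intro k
    rw [← toLinAlgEquiv'_apply, AlgEquiv.apply_symm_apply]
    exact mem_eigenspace_iff.1 (hd k)
  refine ⟨g, d, (toLinAlgEquiv' (R := K) (n := Fin n)).symm m, ?_, hm.map _, fun Z hZ => ?_⟩
  · rw [← hsd, ← map_add, add_comm, ← hY, AlgEquiv.symm_apply_apply]
  · rw [← hsd]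
    have hc : Commute (toLinAlgEquiv' Z) s :=
      Algebra.commute_of_mem_adjoin_singleton_of_commute hs
        (hZ.map (toLinAlgEquiv' (R := K) (n := Fin n)))
    simpa using hc.map (toLinAlgEquiv' (R := K) (n := Fin n)).symm

lemma eq_smul_of_mem_maxGenEigenspace {ι V : Type*} [AddCommGroup V] [Module K V]
    {f : Module.End K V} (L : ι → V →ₗ[K] K) (hL : ∀ v, (∀ i, L i v = 0) → v = 0) (c : ι → K)
    (h : ∀ i v, L i (f v) = c i * L i v) {μ : K} {v : V} (hv : v ∈ f.maxGenEigenspace μ) :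
    f v = μ • v := by
  rw [← sub_eq_zero]
  refine hL _ fun i => ?_
  have hi := map_mem_maxGenEigenspace (L i) f (c i • (1 : Module.End K K)) (fun v => h i v) hv
  rw [mem_maxGenEigenspace] at hi
  obtain ⟨l, hl⟩ := hi
  have hsub : c i • (1 : Module.End K K) - μ • 1 = (c i - μ) • 1 := (sub_smul _ _ _).symm
  rw [hsub, smul_pow, one_pow] at hl
  simp only [LinearMap.smul_apply, Module.End.one_apply, smul_eq_mul, mul_eq_zero] at hl
  rw [map_sub, map_smul, h, smul_eq_mul, ← sub_mul]
  rcases hl with hl | hl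
  · rw [eq_zero_of_pow_eq_zero hl, zero_mul]
  · rw [hl, mul_zero]

lemma conjDiag_eigenvector_of_maxGen {g : GL (Fin n) K} {d : Fin n → K} {μ : K} {v : Fin n → K}
    (hv : v ∈ maxGenEigenspace (toLin' (conjDiag g d)) μ) : conjDiag g d *ᵥ v = μ • v := by
  refine eq_smul_of_mem_maxGenEigenspace
    (fun k => LinearMap.proj k ∘ₗ toLin' (g⁻¹ : GL (Fin n) K).val) (fun v hv => ?_) d
    (fun k v => ?_) hv
  · have h0 : (g⁻¹ : GL (Fin n) K).val *ᵥ v = 0 := funext hv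
    rw [← one_mulVec v, ← GL_val_mul_val_inv g, ← mulVec_mulVec, h0, mulVec_zero]
  · change ((g⁻¹ : GL (Fin n) K).val *ᵥ (conjDiag g d *ᵥ v)) k =
      d k * ((g⁻¹ : GL (Fin n) K).val *ᵥ v) k
    rw [mulVec_mulVec, conjDiag, ← mul_assoc, ← mul_assoc, GL_val_inv_mul_val, one_mul,
      ← mulVec_mulVec, mulVec_diagonal]

/-- Commuting diagonalizable matrices are simultaneously diagonalizable. -/
lemma exists_simultaneous_conjDiag [IsAlgClosed K] {ι : Type*}
    (F : ι → Matrix (Fin n) (Fin n) K) (hF : ∀ i, ∃ g d, F i = conjDiag g d)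
    (hc : ∀ i j, Commute (F i) (F j)) : ∃ g : GL (Fin n) K, ∀ i, ∃ d, F i = conjDiag g d := by
  have htop := iSup_iInf_maxGenEigenspace_eq_top_of_iSup_maxGenEigenspace_eq_top_of_commute
    (fun i => toLin' (F i)) (fun i j _ => (hc i j).map (toLinAlgEquiv' (R := K) (n := Fin n)))
    (fun i => iSup_maxGenEigenspace_eq_top _)
  obtain ⟨g, hg⟩ := exists_GL_of_span_eq_top
    (S := ⋃ χ : ι → K, ((⨅ i, maxGenEigenspace (toLin' (F i)) (χ i) :) : Set (Fin n → K)))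
    (by simp_rw [Submodule.span_iUnion, Submodule.span_eq]; exact htop)
  choose χ hχ using fun k => Set.mem_iUnion.1 (hg k)
  refine ⟨g, fun i => ⟨fun k => χ k i, eq_conjDiag_of_mulVec fun k => ?_⟩⟩
  obtain ⟨g', d', hi⟩ := hF i
  have := (Submodule.mem_iInf _).1 (hχ k) i
  rw [hi] at this ⊢
  exact conjDiag_eigenvector_of_maxGen this

end ConjDiag

/-- Finitely many elements of a field of characteristic zero are integral combinations of
finitely many `ℤ`-independent ones. -/
lemma exists_int_coordinates [CharZero K] {n : ℕ} (d : Fin n → K) :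
    ∃ (r : ℕ) (a : Fin r → Fin n → ℤ) (e : Fin r → K), LinearIndependent ℤ e ∧
      ∀ k, d k = ∑ i, (a i k : K) * e i := by
  let Λ := Submodule.span ℤ (Set.range d)
  have : Module.Finite ℤ Λ := Module.Finite.span_of_finite ℤ (Set.finite_range d)
  let b := Module.finBasis ℤ Λ
  refine ⟨_, fun i k => b.repr ⟨d k, Submodule.subset_span ⟨k, rfl⟩⟩ i, fun i => (b i : K), ?_, ?_⟩
  · exact b.linearIndependent.map' Λ.subtype (by simp)
  · intro k
    have := congrArg Λ.subtype (b.sum_repr ⟨d k, Submodule.subset_span ⟨k, rfl⟩⟩)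
    rw [map_sum] at this
    simpa [zsmul_eq_mul] using this.symm

open MatPoly

section ZariskiClosed

attribute [local instance] LieRing.ofAssociativeRing

variable {n : ℕ}

/-- The polynomial functions vanishing on a subset of `GL n K`. -/
def vanishing (s : Set (GL (Fin n) K)) : Submodule K (MatPoly n K) where
  carrier := {p | ∀ A ∈ s, eval (matOf A) p = 0}
  add_mem' hp hq A hA := by rw [map_add, hp A hA, hq A hA, add_zero]
  zero_mem' A _ := map_zero _
  smul_mem' c p hp A hA := by rw [smul_eval, hp A hA, mul_zero]

lemma vanishing_anti {s t : Set (GL (Fin n) K)} (h : s ⊆ t) : vanishing t ≤ vanishing s :=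
  fun _ hp A hA => hp A (h hA)

lemma IsZClosed.mem_of_forall_eval {s : Set (GL (Fin n) K)} (hs : IsZClosed s) {A : GL (Fin n) K}
    (h : ∀ p ∈ vanishing s, eval (matOf A) p = 0) : A ∈ s := by
  obtain ⟨I, rfl⟩ := hs
  exact fun p hp => h p fun B hB => hB p hp

/-- The Zariski closure of a subset of `GL n K`. -/
def zClosure (s : Set (GL (Fin n) K)) : Set (GL (Fin n) K) :=
  {A | ∀ p ∈ vanishing s, eval (matOf A) p = 0}

lemma isZClosed_zClosure (s : Set (GL (Fin n) K)) : IsZClosed (zClosure s) :=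
  ⟨vanishing s, rfl⟩

lemma subset_zClosure (s : Set (GL (Fin n) K)) : s ⊆ zClosure s := fun _ hA _ hp => hp _ hA

lemma IsZClosed.zClosure_subset {s t : Set (GL (Fin n) K)} (ht : IsZClosed t) (h : s ⊆ t) :
    zClosure s ⊆ t :=
  fun _ hA => ht.mem_of_forall_eval fun p hp => hA p (vanishing_anti h hp)

lemma rightTranslate_mem_vanishing {H : Subgroup (GL (Fin n) K)} {g : GL (Fin n) K} (hg : g ∈ H)
    {p : MatPoly n K} (hp : p ∈ vanishing (H : Set (GL (Fin n) K))) :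
    rightTranslate g p ∈ vanishing (H : Set (GL (Fin n) K)) :=
  fun A hA => by rw [eval_rightTranslate]; exact hp _ (H.mul_mem hA hg)

lemma leftTranslate_mem_vanishing {H : Subgroup (GL (Fin n) K)} {g : GL (Fin n) K} (hg : g ∈ H)
    {p : MatPoly n K} (hp : p ∈ vanishing (H : Set (GL (Fin n) K))) :
    leftTranslate g p ∈ vanishing (H : Set (GL (Fin n) K)) :=
  fun A hA => by rw [eval_leftTranslate]; exact hp _ (H.mul_mem hg hA)

lemma IsZClosed.mem_of_rightTranslate {H : Subgroup (GL (Fin n) K)}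
    (hH : IsZClosed (H : Set (GL (Fin n) K))) {g : GL (Fin n) K}
    (h : ∀ p ∈ vanishing (H : Set (GL (Fin n) K)),
      rightTranslate g p ∈ vanishing (H : Set (GL (Fin n) K))) : g ∈ H :=
  hH.mem_of_forall_eval fun p hp => by
    have := h p hp 1 H.one_mem
    rwa [eval_rightTranslate, one_mul] at this

/-- The Lie algebra of a subgroup of `GL n K`. -/
noncomputable def lieAlg (H : Subgroup (GL (Fin n) K)) :
    LieSubalgebra K (Matrix (Fin n) (Fin n) K) where
  carrier := {Z | ∀ p ∈ vanishing (H : Set (GL (Fin n) K)),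
    lieDeriv Z p ∈ vanishing (H : Set (GL (Fin n) K))}
  add_mem' hY hZ p hp := by
    rw [lieDeriv_add, Derivation.add_apply]
    exact Submodule.add_mem _ (hY p hp) (hZ p hp)
  zero_mem' p _ := by
    have : lieDeriv (0 : Matrix (Fin n) (Fin n) K) = 0 := map_zero lieDerivₗ
    rw [this]
    exact Submodule.zero_mem _
  smul_mem' c Z hZ p hp := by
    rw [lieDeriv_smul, Derivation.smul_apply]
    exact Submodule.smul_mem _ _ (hZ p hp)
  lie_mem' hY hZ p hp := by
    rw [lieDeriv_lie, Derivation.commutator_apply]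
    exact Submodule.sub_mem _ (hY _ (hZ p hp)) (hZ _ (hY p hp))

lemma mem_lieAlg_iff_eval_one {H : Subgroup (GL (Fin n) K)} {Z : Matrix (Fin n) (Fin n) K} :
    Z ∈ lieAlg H ↔ ∀ p ∈ vanishing (H : Set (GL (Fin n) K)),
      eval (matOf 1) (lieDeriv Z p) = 0 := by
  refine ⟨fun h p hp => h p hp 1 H.one_mem, fun h p hp A hA => ?_⟩
  have := h _ (leftTranslate_mem_vanishing hA hp)
  rwa [← leftTranslate_lieDeriv, eval_leftTranslate, mul_one] at this

lemma lieAlg_mono {H G : Subgroup (GL (Fin n) K)} (h : H ≤ G) {Z : Matrix (Fin n) (Fin n) K}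
    (hZ : Z ∈ lieAlg H) : Z ∈ lieAlg G :=
  mem_lieAlg_iff_eval_one.2 fun p hp => mem_lieAlg_iff_eval_one.1 hZ p (vanishing_anti h hp)

lemma conj_mem_lieAlg {H : Subgroup (GL (Fin n) K)} {g : GL (Fin n) K} (hg : g ∈ H)
    {Z : Matrix (Fin n) (Fin n) K} (hZ : Z ∈ lieAlg H) :
    (g : Matrix (Fin n) (Fin n) K) * Z * ((g⁻¹ : GL (Fin n) K) : Matrix (Fin n) (Fin n) K) ∈
      lieAlg H := by
  rw [mem_lieAlg_iff_eval_one]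
  intro p hp
  have h := rightTranslate_lieDeriv g Z (rightTranslate g⁻¹ p)
  have h2 : eval (matOf 1) (lieDeriv ((g : Matrix (Fin n) (Fin n) K) * Z *
      ((g⁻¹ : GL (Fin n) K) : Matrix (Fin n) (Fin n) K)) (rightTranslate g
        (rightTranslate g⁻¹ p))) = 0 := by
    rw [← h]
    exact rightTranslate_mem_vanishing hg
      (hZ _ (rightTranslate_mem_vanishing (H.inv_mem hg) hp)) 1 H.one_mem
  have h3 : (rightTranslate g).comp (rightTranslate g⁻¹) = AlgHom.id K (MatPoly n K) := by
    ext q : 1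
    rcases q with ⟨i, k⟩ | ⟨k, j⟩
    · rw [← mulVecPoly_single, AlgHom.comp_apply, rightTranslate_mulVecPoly,
        rightTranslate_mulVecPoly, mulVec_mulVec, GL_val_mul_val_inv, one_mulVec, AlgHom.id_apply]
    · rw [← vecMulPoly_single, AlgHom.comp_apply, rightTranslate_vecMulPoly,
        rightTranslate_vecMulPoly, vecMul_vecMul, GL_val_inv_mul_val, vecMul_one, AlgHom.id_apply]
  rwa [← AlgHom.comp_apply, h3, AlgHom.id_apply] at h2

end ZariskiClosed

section JordanParts

attribute [local instance] LieRing.ofAssociativeRing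

open Module.End

variable {n : ℕ}

lemma mem_maxGenEigenspace_add {V : Type*} [AddCommGroup V] [Module K V] {s m : Module.End K V}
    (hc : Commute s m) (hm : IsNilpotent m) {μ : K} {v : V} (hv : s v = μ • v) :
    v ∈ (s + m).maxGenEigenspace μ := by
  obtain ⟨l, hl⟩ := hm
  rw [mem_maxGenEigenspace]
  refine ⟨l, ?_⟩
  have key : ∀ l : ℕ, ((s + m - μ • (1 : Module.End K V)) ^ l) v = (m ^ l) v := by
    intro l
    induction l with
    | zero => simp
    | succ l ih =>
      have h := congrArg (· v) (hc.pow_right l).eq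
      simp only [Module.End.mul_apply] at h
      rw [pow_succ', Module.End.mul_apply, ih, pow_succ', Module.End.mul_apply]
      simp only [LinearMap.sub_apply, LinearMap.add_apply, LinearMap.smul_apply,
        Module.End.one_apply]
      rw [h, hv, map_smul]
      abel
  rw [key, hl, LinearMap.zero_apply]

lemma mulVec_mem_maxGenEigenspace {s m : Matrix (Fin n) (Fin n) K} (hc : Commute s m)
    (hm : IsNilpotent m) {μ : K} {v : Fin n → K} (hv : s *ᵥ v = μ • v) :
    v ∈ maxGenEigenspace (toLin' (s + m)) μ := by
  rw [map_add]
  exact mem_maxGenEigenspace_add (hc.map (toLinAlgEquiv' (R := K) (n := Fin n)))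
    (hm.map (toLinAlgEquiv' (R := K) (n := Fin n))) hv

lemma vecMul_mem_maxGenEigenspace {s m : Matrix (Fin n) (Fin n) K} (hc : Commute s m)
    (hm : IsNilpotent m) {μ : K} {v : Fin n → K} (hv : v ᵥ* s = μ • v) :
    v ∈ maxGenEigenspace (toLin' (s + m)ᵀ) μ := by
  rw [transpose_add]
  refine mulVec_mem_maxGenEigenspace ?_ ?_ (by rwa [mulVec_transpose])
  · have := congrArg transpose hc.eq
    rw [transpose_mul, transpose_mul] at this
    exact this.symm
  · obtain ⟨l, hl⟩ := hm
    exact ⟨l, by rw [← transpose_pow, hl, transpose_zero]⟩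

lemma Derivation.mul_mem_eigenspace {P : Type*} [CommRing P] [Algebra K P] (D : Derivation K P P)
    {μ ν : K} {p q : P} (hp : D p = μ • p) (hq : D q = ν • q) :
    D (p * q) = (μ + ν) • (p * q) := by
  rw [D.leibniz, hp, hq, add_smul, smul_eq_mul, smul_eq_mul, mul_smul_comm, mul_smul_comm,
    mul_comm q p, add_comm]

/-- The functions that are weight vectors for the additive Jordan decomposition `X = s + m`:
generalized eigenvectors of `X` on which the cocharacters of `s` act by scalars. -/
noncomputable def cocharWeight {r : ℕ} (X : Matrix (Fin n) (Fin n) K) (g : GL (Fin n) K)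
    (a : Fin r → Fin n → ℤ) (e : Fin r → K) (v : Fin r → ℤ) : Submodule K (MatPoly n K) :=
  maxGenEigenspace (lieDeriv X : MatPoly n K →ₗ[K] MatPoly n K) (∑ i, (v i : K) * e i) ⊓
  (⨅ i, ⨅ c : Kˣ, eigenspace (rightTranslate (conjDiagGL g fun k => c ^ a i k)).toLinearMap
    ((c ^ v i : Kˣ) : K)) ⊓
  ⨅ i, eigenspace (lieDeriv (conjDiag g fun k => (a i k : K)) : MatPoly n K →ₗ[K] MatPoly n K)
    (v i : K)

lemma mem_cocharWeight {r : ℕ} {X : Matrix (Fin n) (Fin n) K} {g : GL (Fin n) K}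
    {a : Fin r → Fin n → ℤ} {e : Fin r → K} {v : Fin r → ℤ} {p : MatPoly n K} :
    p ∈ cocharWeight X g a e v ↔
      p ∈ maxGenEigenspace (lieDeriv X : MatPoly n K →ₗ[K] MatPoly n K) (∑ i, (v i : K) * e i) ∧
      (∀ i (c : Kˣ), rightTranslate (conjDiagGL g fun k => c ^ a i k) p = ((c ^ v i : Kˣ) : K) • p) ∧
      ∀ i, lieDeriv (conjDiag g fun k => (a i k : K)) p = (v i : K) • p := by
  simp only [cocharWeight, Submodule.mem_inf, Submodule.mem_iInf, mem_eigenspace_iff,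
    AlgHom.toLinearMap_apply, Derivation.coeFn_coe, and_assoc]

lemma iSup_cocharWeight {r : ℕ} {g : GL (Fin n) K} {d : Fin n → K} {m : Matrix (Fin n) (Fin n) K}
    (hm : IsNilpotent m) (hc : Commute m (conjDiag g d)) {a : Fin r → Fin n → ℤ} {e : Fin r → K}
    (hd : ∀ k, d k = ∑ i, (a i k : K) * e i) :
    ⨆ v, cocharWeight (conjDiag g d + m) g a e v = ⊤ := by
  refine iSup_weight_eq_top _ ?_ ?_ g (fun k i => a i k) ?_ ?_
  · rw [mem_cocharWeight]
    refine ⟨?_, fun i c => by simp, fun i => by simp⟩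
    rw [mem_maxGenEigenspace]
    exact ⟨1, by simp⟩
  · intro v w p hp q hq
    rw [mem_cocharWeight] at *
    refine ⟨?_, fun i c => ?_, fun i => ?_⟩
    · have hvw : ∑ i, ((v + w) i : K) * e i = ∑ i, (v i : K) * e i + ∑ i, (w i : K) * e i := by
        rw [← Finset.sum_add_distrib]
        refine Finset.sum_congr rfl fun i _ => ?_
        rw [Pi.add_apply, Int.cast_add, add_mul]
      rw [hvw]
      exact Derivation.mul_mem_maxGenEigenspace _ hp.1 hq.1
    · rw [map_mul, hp.2.1, hq.2.1, smul_mul_smul_comm, Pi.add_apply, _root_.zpow_add, Units.val_mul]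
    · rw [Derivation.mul_mem_eigenspace _ (hp.2.2 i) (hq.2.2 i), Pi.add_apply, Int.cast_add]
  · intro j k
    rw [mem_cocharWeight]
    refine ⟨?_, fun i c => ?_, fun i => ?_⟩
    · rw [← hd]
      exact map_mem_maxGenEigenspace (mulVecPoly j) (toLin' (conjDiag g d + m)) _
        (fun w => by rw [toLin'_apply]; exact (lieDeriv_mulVecPoly _ _ _).symm)
        (mulVec_mem_maxGenEigenspace hc.symm hm (conjDiag_mulVec_single g d k))
    · rw [rightTranslate_mulVecPoly, conjDiagGL_val, conjDiag_mulVec_single, map_smul]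
    · rw [lieDeriv_mulVecPoly, conjDiag_mulVec_single, map_smul]
  · intro j k
    rw [mem_cocharWeight]
    refine ⟨?_, fun i c => ?_, fun i => ?_⟩
    · have hv : (∑ i, (((-fun i => a i k) i : ℤ) : K) * e i) = - d k := by
        rw [hd, ← Finset.sum_neg_distrib]
        refine Finset.sum_congr rfl fun i _ => ?_
        rw [Pi.neg_apply, Int.cast_neg, neg_mul]
      rw [hv]
      refine map_mem_maxGenEigenspace (vecMulPoly j) (toLin' (-conjDiag g d + -m)ᵀ) _ (fun w => ?_)
        (vecMul_mem_maxGenEigenspace hc.symm.neg_left.neg_right hm.neg ?_)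
      · rw [toLin'_apply, mulVec_transpose, ← neg_add, vecMul_neg, map_neg]
        exact (lieDeriv_vecMulPoly _ _ _).symm
      · rw [vecMul_neg, single_vecMul_conjDiag, neg_smul]
    · rw [rightTranslate_vecMulPoly, conjDiagGL_inv_val, single_vecMul_conjDiag, map_smul,
        Pi.neg_apply, _root_.zpow_neg]
    · rw [lieDeriv_vecMulPoly, single_vecMul_conjDiag, map_smul, Pi.neg_apply, Int.cast_neg,
        neg_smul]

lemma sum_intCast_mul_injective [CharZero K] {r : ℕ} {e : Fin r → K} (he : LinearIndependent ℤ e) :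
    Function.Injective fun v : Fin r → ℤ => ∑ i, (v i : K) * e i := by
  intro v w h
  have := he.eq_coords_of_eq (f := v) (g := w) (by simpa [zsmul_eq_mul] using h)
  exact funext this

/-- The cocharacters of the semisimple part of an element of the Lie algebra of a closed
subgroup belong to the subgroup, and so do their derivatives for the Lie algebra. -/
lemma cochar_mem [CharZero K] {r : ℕ} {H : Subgroup (GL (Fin n) K)}
    (hH : IsZClosed (H : Set (GL (Fin n) K))) {g : GL (Fin n) K} {d : Fin n → K}
    {m : Matrix (Fin n) (Fin n) K} (hX : conjDiag g d + m ∈ lieAlg H)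
    (hm : IsNilpotent m) (hc : Commute m (conjDiag g d)) {a : Fin r → Fin n → ℤ} {e : Fin r → K}
    (he : LinearIndependent ℤ e) (hd : ∀ k, d k = ∑ i, (a i k : K) * e i) (i : Fin r) :
    conjDiag g (fun k => (a i k : K)) ∈ lieAlg H ∧
      ∀ c : Kˣ, conjDiagGL g (fun k => c ^ a i k) ∈ H := by
  have hE : ∀ v, cocharWeight (conjDiag g d + m) g a e v ≤ maxGenEigenspace
      (lieDeriv (conjDiag g d + m) : MatPoly n K →ₗ[K] MatPoly n K) (∑ i, (v i : K) * e i) :=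
    fun v p hp => (mem_cocharWeight.1 hp).1
  have htop := iSup_cocharWeight hm hc hd
  constructor
  · exact fun p hp => scalar_on_components_mem hX (sum_intCast_mul_injective he) hE htop
      (Ψ := (lieDeriv (conjDiag g fun k => (a i k : K)) : MatPoly n K →ₗ[K] MatPoly n K))
      (ψ := fun v => (v i : K)) (fun v p hp => (mem_cocharWeight.1 hp).2.2 i) hp
  · exact fun c => hH.mem_of_rightTranslate fun p hp =>
      scalar_on_components_mem hX (sum_intCast_mul_injective he) hE htop
      (Ψ := (rightTranslate (conjDiagGL g fun k => c ^ a i k)).toLinearMap)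
      (ψ := fun v => ((c ^ v i : Kˣ) : K)) (fun v p hp => (mem_cocharWeight.1 hp).2.1 i c) hp

lemma conjDiag_mem_lieAlg [CharZero K] {H : Subgroup (GL (Fin n) K)}
    (hH : IsZClosed (H : Set (GL (Fin n) K))) {g : GL (Fin n) K} {d : Fin n → K}
    {m : Matrix (Fin n) (Fin n) K} (hX : conjDiag g d + m ∈ lieAlg H)
    (hm : IsNilpotent m) (hc : Commute m (conjDiag g d)) : conjDiag g d ∈ lieAlg H := by
  obtain ⟨r, a, e, he, hd⟩ := exists_int_coordinates d
  have : d = ∑ i, e i • fun k => (a i k : K) := by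
    ext k
    rw [hd, Finset.sum_apply]
    exact Finset.sum_congr rfl fun i _ => mul_comm _ _
  rw [this, conjDiag_sum_smul]
  exact sum_mem fun i _ => (lieAlg H).smul_mem _ (cochar_mem hH hX hm hc he hd i).1

lemma iSup_eigenspace_lieDeriv (g : GL (Fin n) K) (d : Fin n → K) :
    ⨆ μ, eigenspace (lieDeriv (conjDiag g d) : MatPoly n K →ₗ[K] MatPoly n K) μ = ⊤ := by
  refine iSup_weight_eq_top _ ?_ ?_ g d ?_ ?_
  · simp
  · intro v w p hp q hq
    rw [mem_eigenspace_iff] at *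
    exact Derivation.mul_mem_eigenspace _ hp hq
  · intro j k
    rw [mem_eigenspace_iff, Derivation.coeFn_coe, lieDeriv_mulVecPoly, conjDiag_mulVec_single,
      map_smul]
  · intro j k
    rw [mem_eigenspace_iff, Derivation.coeFn_coe, lieDeriv_vecMulPoly, single_vecMul_conjDiag,
      map_smul, neg_smul]

lemma iSup_eigenspace_rightTranslate (g : GL (Fin n) K) (d : Fin n → Kˣ) :
    ⨆ μ : Additive Kˣ, eigenspace (rightTranslate (conjDiagGL g d)).toLinearMap
      ((μ.toMul : Kˣ) : K) = ⊤ := by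
  refine iSup_weight_eq_top _ ?_ ?_ g (fun k => Additive.ofMul (d k)) ?_ ?_
  · simp
  · intro v w p hp q hq
    rw [mem_eigenspace_iff, AlgHom.toLinearMap_apply] at *
    rw [map_mul, hp, hq, smul_mul_smul_comm, toMul_add, Units.val_mul]
  · intro j k
    rw [mem_eigenspace_iff, AlgHom.toLinearMap_apply, rightTranslate_mulVecPoly, conjDiagGL_val,
      conjDiag_mulVec_single, map_smul, toMul_ofMul]
  · intro j k
    rw [mem_eigenspace_iff, AlgHom.toLinearMap_apply, rightTranslate_vecMulPoly,
      conjDiagGL_inv_val, single_vecMul_conjDiag, map_smul, toMul_neg, toMul_ofMul]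

/-- The semisimple part of an element of a closed subgroup belongs to the subgroup. -/
lemma conjDiagGL_mem {H : Subgroup (GL (Fin n) K)}
    (hH : IsZClosed (H : Set (GL (Fin n) K))) {u g : GL (Fin n) K} (hu : u ∈ H) {d : Fin n → Kˣ}
    {m : Matrix (Fin n) (Fin n) K} (hm : IsNilpotent m)
    (hud : (u : Matrix (Fin n) (Fin n) K) = conjDiagGL g d + m)
    (hc : Commute m (conjDiagGL g d : Matrix (Fin n) (Fin n) K)) : conjDiagGL g d ∈ H := by
  set s := conjDiagGL g d with hs
  have hcu : Commute u s := by
    apply Units.ext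
    change (u : Matrix (Fin n) (Fin n) K) * s = s * u
    rw [hud, add_mul, mul_add, hc.eq]
  let m' : Matrix (Fin n) (Fin n) K := (u⁻¹ : GL (Fin n) K).val - (s⁻¹ : GL (Fin n) K).val
  have hcm' : Commute (s⁻¹ : GL (Fin n) K).val m' := by
    refine Commute.sub_right ?_ (Commute.refl _)
    exact congrArg Units.val (hcu.inv_inv.symm : Commute s⁻¹ u⁻¹).eq
  have hm' : IsNilpotent m' := by
    have h1 : m' = -(m * ((u⁻¹ : GL (Fin n) K).val * (s⁻¹ : GL (Fin n) K).val)) := by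
      have : m = (u : Matrix (Fin n) (Fin n) K) - s := by rw [hud, add_sub_cancel_left]
      rw [this, sub_mul, ← mul_assoc, GL_val_mul_val_inv, one_mul,
        show (u⁻¹ : GL (Fin n) K).val * (s⁻¹ : GL (Fin n) K).val =
          (s⁻¹ : GL (Fin n) K).val * (u⁻¹ : GL (Fin n) K).val from
          congrArg Units.val (hcu.inv_inv : Commute u⁻¹ s⁻¹).eq, ← mul_assoc, GL_val_mul_val_inv,
        one_mul]
      simp only [m']
      abel
    rw [h1]
    refine (Commute.isNilpotent_mul_right ?_ hm).neg
    have hmu : Commute m (u : Matrix (Fin n) (Fin n) K) := by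
      rw [hud]
      exact hc.add_right (Commute.refl _)
    exact (hmu.units_inv_right (u := u)).mul_right (hc.units_inv_right (u := s))
  let E : Additive Kˣ → Submodule K (MatPoly n K) := fun v =>
    maxGenEigenspace (rightTranslate u).toLinearMap ((v.toMul : Kˣ) : K) ⊓
      eigenspace (rightTranslate s).toLinearMap ((v.toMul : Kˣ) : K)
  have htop : ⨆ v, E v = ⊤ := by
    refine iSup_weight_eq_top _ ?_ ?_ g (fun k => Additive.ofMul (d k)) ?_ ?_
    · refine ⟨?_, by simp⟩
      change _ ∈ maxGenEigenspace _ _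
      rw [mem_maxGenEigenspace]
      exact ⟨1, by simp⟩
    · rintro v w p ⟨hp, hp'⟩ q ⟨hq, hq'⟩
      refine ⟨?_, ?_⟩
      · have := AlgHom.mul_mem_maxGenEigenspace _ hp hq
        rwa [← Units.val_mul, ← toMul_add] at this
      · change _ ∈ eigenspace _ _ at hp' hq' ⊢
        rw [mem_eigenspace_iff, AlgHom.toLinearMap_apply] at *
        rw [map_mul, hp', hq', smul_mul_smul_comm, toMul_add, Units.val_mul]
    · intro j k
      refine ⟨?_, ?_⟩
      · refine map_mem_maxGenEigenspace (mulVecPoly j) (toLin' ((s : Matrix (Fin n) (Fin n) K) + m)) _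
          (fun w => ?_)
          (mulVec_mem_maxGenEigenspace hc.symm hm (conjDiag_mulVec_single g _ k))
        rw [toLin'_apply, ← hud]
        exact (rightTranslate_mulVecPoly _ _ _).symm
      · change _ ∈ eigenspace _ _
        rw [mem_eigenspace_iff, AlgHom.toLinearMap_apply, rightTranslate_mulVecPoly, hs,
          conjDiagGL_val, conjDiag_mulVec_single, map_smul, toMul_ofMul]
    · intro j k
      refine ⟨?_, ?_⟩
      · refine map_mem_maxGenEigenspace (vecMulPoly j) (toLin' ((s⁻¹ : GL (Fin n) K).val + m')ᵀ) _
          (fun w => ?_) (vecMul_mem_maxGenEigenspace hcm' hm' (single_vecMul_conjDiag g _ k))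
        rw [toLin'_apply, mulVec_transpose, add_sub_cancel]
        exact (rightTranslate_vecMulPoly _ _ _).symm
      · change _ ∈ eigenspace _ _
        rw [mem_eigenspace_iff, AlgHom.toLinearMap_apply, rightTranslate_vecMulPoly, hs,
          conjDiagGL_inv_val, single_vecMul_conjDiag, map_smul, toMul_neg, toMul_ofMul]
  refine hH.mem_of_rightTranslate fun p hp => ?_
  exact scalar_on_components_mem (Φ := (rightTranslate u).toLinearMap)
    (fun p hp => rightTranslate_mem_vanishing hu hp)
    (Units.val_injective.comp Additive.toMul.injective) (fun v => inf_le_left) htop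
    (Ψ := (rightTranslate s).toLinearMap) (ψ := fun v => ((v.toMul : Kˣ) : K))
    (fun v p hp => mem_eigenspace_iff.1 hp.2) hp

end JordanParts

section NilpotentLogarithm

open IsNilpotent

lemma IsNilpotent.exists_exp_eq_one_add_add {B : Type*} [CommRing B] [Algebra ℚ B] {x : B}
    (hx : IsNilpotent x) : ∃ r, exp x = 1 + x + x ^ 2 * r := by
  obtain ⟨k, hk⟩ := hx
  refine ⟨∑ i ∈ Finset.range k, ((i + 2).factorial : ℚ)⁻¹ • x ^ i, ?_⟩
  rw [exp_eq_sum (k := k + 2) (by rw [pow_add, hk, zero_mul]), Finset.sum_range_succ',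
    Finset.sum_range_succ', Finset.mul_sum]
  simp only [zero_add, pow_zero, pow_one, Nat.factorial_zero, Nat.factorial_one, Nat.cast_one,
    inv_one, one_smul]
  rw [add_assoc, add_comm, add_comm x]
  congr 1
  refine Finset.sum_congr rfl fun i _ => ?_
  rw [mul_smul_comm, ← pow_add, add_assoc, add_comm i]

lemma IsNilpotent.exists_exp_eq_one_add_of_comm {B : Type*} [CommRing B] [Algebra ℚ B] {x : B}
    (hx : IsNilpotent x) : ∃ y, IsNilpotent y ∧ exp y = 1 + x := by
  have key : ∀ k : ℕ, ∃ y, x ∣ y ∧ ∃ q, exp y = 1 + x + x ^ (k + 1) * q := by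
    intro k
    induction k with
    | zero => exact ⟨0, dvd_zero x, -1, by rw [exp_zero]; ring⟩
    | succ k ih =>
      obtain ⟨y, hxy, q, hq⟩ := ih
      have hy : IsNilpotent y := by
        obtain ⟨z, rfl⟩ := hxy
        exact (Commute.all x z).isNilpotent_mul_right hx
      have hz : IsNilpotent (-(x ^ (k + 1) * q)) :=
        ((Commute.all _ q).isNilpotent_mul_right (IsNilpotent.pow_succ k hx)).neg
      obtain ⟨r, hr⟩ := hz.exists_exp_eq_one_add_add
      refine ⟨y + -(x ^ (k + 1) * q), dvd_add hxy ((dvd_neg).2 ?_),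
        -q - x ^ k * q ^ 2 + x ^ k * q ^ 2 * r * (1 + x + x ^ (k + 1) * q), ?_⟩
      · exact Dvd.dvd.mul_right (dvd_pow_self x k.succ_ne_zero) q
      · rw [exp_add_of_commute (Commute.all _ _) hy hz, hr, hq]
        ring
  obtain ⟨k, hk⟩ := id hx
  obtain ⟨y, ⟨z, rfl⟩, q, hq⟩ := key k
  exact ⟨x * z, (Commute.all x z).isNilpotent_mul_right hx, by
    rw [hq, _root_.pow_succ, hk, zero_mul, zero_mul, add_zero]⟩

lemma IsNilpotent.exists_exp_eq_one_add [CharZero K] {A : Type*} [Ring A] [Algebra K A]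
    [Module ℚ A] {x : A} (hx : IsNilpotent x) : ∃ y, IsNilpotent y ∧ exp y = 1 + x := by
  obtain ⟨k, hk⟩ := hx
  let I : Ideal (Polynomial K) := Ideal.span {Polynomial.X ^ k}
  let φ : Polynomial K ⧸ I →ₐ[K] A := Ideal.Quotient.liftₐ I (Polynomial.aeval x) (fun p hp => by
    obtain ⟨q, rfl⟩ := Ideal.mem_span_singleton'.1 hp
    rw [map_mul, map_pow, Polynomial.aeval_X, hk, mul_zero])
  have hX : IsNilpotent (Ideal.Quotient.mk I Polynomial.X) :=
    ⟨k, by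
      rw [← map_pow]
      exact Ideal.Quotient.eq_zero_iff_mem.2 (Ideal.mem_span_singleton_self _)⟩
  obtain ⟨y, hy, hyx⟩ := hX.exists_exp_eq_one_add_of_comm
  refine ⟨φ y, hy.map φ, ?_⟩
  rw [← map_exp hy φ, hyx, map_add, map_one]
  congr 1
  exact Polynomial.aeval_X x

end NilpotentLogarithm

section Exponential

open IsNilpotent

variable {n : ℕ} [CharZero K]

/-- The exponential of a nilpotent matrix. -/
noncomputable def expGL (N : Matrix (Fin n) (Fin n) K) (hN : IsNilpotent N) : GL (Fin n) K where
  val := exp N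
  inv := exp (-N)
  val_inv := exp_mul_exp_neg_self hN
  inv_val := exp_neg_mul_exp_self hN

lemma expGL_val (N : Matrix (Fin n) (Fin n) K) (hN : IsNilpotent N) :
    (expGL N hN : Matrix (Fin n) (Fin n) K) = exp N := rfl

lemma expGL_inv_val (N : Matrix (Fin n) (Fin n) K) (hN : IsNilpotent N) :
    ((expGL N hN)⁻¹ : GL (Fin n) K).val = exp (-N) := rfl

lemma expGL_zero_smul (N : Matrix (Fin n) (Fin n) K) (hN : IsNilpotent N) :
    expGL ((0 : K) • N) (hN.smul 0) = 1 := by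
  apply Units.ext
  rw [expGL_val, zero_smul, exp_zero]
  rfl

lemma expGL_natCast_smul (N : Matrix (Fin n) (Fin n) K) (hN : IsNilpotent N) (k : ℕ) :
    expGL ((k : K) • N) (hN.smul _) = expGL N hN ^ k := by
  induction k with
  | zero => simpa using expGL_zero_smul N hN
  | succ k ih =>
    rw [_root_.pow_succ, ← ih]
    apply Units.ext
    rw [Units.val_mul, expGL_val, expGL_val, expGL_val, ← exp_add_of_commute
      ((Commute.refl N).smul_left _) (hN.smul _) hN, Nat.cast_succ, add_smul, one_smul]

/-- The polynomial curve `t ↦ p (exp (t N))`. -/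
noncomputable def expCurve (N : Matrix (Fin n) (Fin n) K) : MatPoly n K →ₐ[K] Polynomial K :=
  aeval (Sum.elim
    (fun q => ∑ k ∈ Finset.range (nilpotencyClass N),
      Polynomial.monomial k ((k.factorial : K)⁻¹ * (N ^ k) q.1 q.2))
    (fun q => ∑ k ∈ Finset.range (nilpotencyClass N),
      Polynomial.monomial k ((k.factorial : K)⁻¹ * ((-N) ^ k) q.1 q.2)))

lemma exp_smul_apply {N : Matrix (Fin n) (Fin n) K} {k : ℕ} (hN : N ^ k = 0) (t : K)
    (i j : Fin n) : exp (t • N) i j =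
      ∑ l ∈ Finset.range k, (l.factorial : K)⁻¹ * (N ^ l) i j * t ^ l := by
  rw [exp_eq_sum (k := k) (by rw [smul_pow, hN, smul_zero]), Matrix.sum_apply]
  refine Finset.sum_congr rfl fun l _ => ?_
  rw [Matrix.smul_apply, smul_pow, Matrix.smul_apply, Rat.smul_def, smul_eq_mul]
  push_cast
  ring

lemma eval_expCurve {N : Matrix (Fin n) (Fin n) K} (hN : IsNilpotent N) (t : K)
    (p : MatPoly n K) :
    (expCurve N p).eval t = eval (matOf (expGL (t • N) (hN.smul t))) p := by
  have h : (Polynomial.aeval t).comp (expCurve N) =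
      (aeval (matOf (expGL (t • N) (hN.smul t))) : MatPoly n K →ₐ[K] K) := by
    have hk := pow_nilpotencyClass hN
    ext q
    rcases q with q | q
    · rw [AlgHom.comp_apply, expCurve, aeval_X, aeval_X]
      simp only [Sum.elim_inl, map_sum, Polynomial.aeval_monomial, matOf, expGL_val,
        exp_smul_apply hk, Algebra.algebraMap_self, RingHom.id_apply]
    · rw [AlgHom.comp_apply, expCurve, aeval_X, aeval_X]
      have hk' : (-N) ^ nilpotencyClass N = 0 := by rw [neg_pow, hk, mul_zero]
      simp only [Sum.elim_inr, map_sum, Polynomial.aeval_monomial, matOf, expGL_inv_val,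
        ← smul_neg, exp_smul_apply hk', Algebra.algebraMap_self, RingHom.id_apply]
  have := DFunLike.congr_fun h p
  rwa [AlgHom.comp_apply, Polynomial.coe_aeval_eq_eval, MvPolynomial.aeval_eq_eval] at this

lemma derivative_sum_monomial {A : Matrix (Fin n) (Fin n) K} {k : ℕ} (hk : A ^ k = 0)
    (i j : Fin n) :
    Polynomial.derivative (∑ l ∈ Finset.range k,
      Polynomial.monomial l ((l.factorial : K)⁻¹ * (A ^ l) i j)) =
    ∑ l ∈ Finset.range k, Polynomial.monomial l ((l.factorial : K)⁻¹ * (A ^ (l + 1)) i j) := by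
  rw [map_sum]
  cases k with
  | zero => simp
  | succ k =>
    rw [Finset.sum_range_succ', Finset.sum_range_succ _ k, hk]
    simp only [Polynomial.derivative_monomial, Nat.cast_zero, mul_zero, Matrix.zero_apply,
      Polynomial.monomial_zero_right, add_zero]
    refine Finset.sum_congr rfl fun l _ => ?_
    rw [Nat.add_sub_cancel, Nat.factorial_succ, Nat.cast_mul]
    have h1 : ((l + 1 : ℕ) : K) ≠ 0 := Nat.cast_ne_zero.2 l.succ_ne_zero
    have h2 : (l.factorial : K) ≠ 0 := Nat.cast_ne_zero.2 l.factorial_ne_zero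
    congr 1
    field_simp

lemma derivative_expCurve {N : Matrix (Fin n) (Fin n) K} (hN : IsNilpotent N) (p : MatPoly n K) :
    Polynomial.derivative (expCurve N p) = expCurve N (lieDeriv N p) := by
  have hk := pow_nilpotencyClass hN
  have hk' : (-N) ^ nilpotencyClass N = 0 := by rw [neg_pow, hk, mul_zero]
  induction p using MvPolynomial.induction_on with
  | C a => rw [← algebraMap_eq, AlgHom.commutes, Derivation.map_algebraMap, map_zero,
      Polynomial.algebraMap_eq, Polynomial.derivative_C]
  | add p q hp hq => simp only [map_add, hp, hq]
  | mul_X p q hp =>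
    have hX : Polynomial.derivative (expCurve N (X q)) = expCurve N (lieDeriv N (X q)) := by
      rcases q with ⟨i, j⟩ | ⟨i, j⟩
      · rw [lieDeriv_X_inl, mulVecPoly_apply, map_sum, expCurve, aeval_X, Sum.elim_inl,
          derivative_sum_monomial hk]
        simp_rw [map_smul, aeval_X, Sum.elim_inl, Finset.smul_sum, Polynomial.smul_monomial]
        rw [Finset.sum_comm]
        refine Finset.sum_congr rfl fun l _ => ?_
        rw [← map_sum, _root_.pow_succ, Matrix.mul_apply, Finset.mul_sum]
        refine congrArg _ (Finset.sum_congr rfl fun x _ => ?_)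
        simp only [mulVec_single_one, col_apply, smul_eq_mul]
        ring
      · rw [lieDeriv_X_inr, vecMulPoly_apply, map_neg, map_sum, expCurve, aeval_X, Sum.elim_inr,
          derivative_sum_monomial hk']
        simp_rw [map_smul, aeval_X, Sum.elim_inr, Finset.smul_sum, Polynomial.smul_monomial]
        rw [Finset.sum_comm, ← Finset.sum_neg_distrib]
        refine Finset.sum_congr rfl fun l _ => ?_
        rw [← map_sum, ← map_neg, pow_succ', Matrix.mul_apply, Finset.mul_sum,
          ← Finset.sum_neg_distrib]
        refine congrArg _ (Finset.sum_congr rfl fun x _ => ?_)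
        simp only [single_one_vecMul, row_apply, smul_eq_mul, Matrix.neg_apply]
        ring
    rw [map_mul, Polynomial.derivative_mul, hp, hX, Derivation.leibniz, map_add, smul_eq_mul,
      smul_eq_mul, map_mul, map_mul]
    ring

lemma expCurve_eq_zero {H : Subgroup (GL (Fin n) K)} {N : Matrix (Fin n) (Fin n) K}
    (hN : IsNilpotent N) (hNH : N ∈ lieAlg H) {p : MatPoly n K}
    (hp : p ∈ vanishing (H : Set (GL (Fin n) K))) : expCurve N p = 0 := by
  have key : ∀ d : ℕ, ∀ p ∈ vanishing (H : Set (GL (Fin n) K)),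
      (expCurve N p).natDegree ≤ d → expCurve N p = 0 := by
    intro d
    induction d with
    | zero =>
      intro p hp hd
      have h0 := eval_expCurve hN 0 p
      rw [expGL_zero_smul N hN, hp 1 H.one_mem] at h0
      rw [Polynomial.eq_C_of_natDegree_le_zero hd] at h0 ⊢
      rw [Polynomial.eval_C] at h0
      rw [h0, map_zero]
    | succ d ih =>
      intro p hp hd
      have hD : (expCurve N (lieDeriv N p)).natDegree ≤ d := by
        rw [← derivative_expCurve hN]
        exact (Polynomial.natDegree_derivative_le _).trans (by omega)
      have h1 : (expCurve N p).natDegree = 0 := by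
        rw [← Polynomial.derivative_eq_zero, derivative_expCurve hN]
        exact ih _ (hNH p hp) hD
      have h0 := eval_expCurve hN 0 p
      rw [expGL_zero_smul N hN, hp 1 H.one_mem] at h0
      rw [Polynomial.eq_C_of_natDegree_eq_zero h1] at h0 ⊢
      rw [Polynomial.eval_C] at h0
      rw [h0, map_zero]
  exact key _ p hp le_rfl

lemma expGL_mem {H : Subgroup (GL (Fin n) K)} (hH : IsZClosed (H : Set (GL (Fin n) K)))
    {N : Matrix (Fin n) (Fin n) K} (hN : IsNilpotent N) (hNH : N ∈ lieAlg H) (t : K) :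
    expGL (t • N) (hN.smul t) ∈ H :=
  hH.mem_of_forall_eval fun p hp => by
    rw [← eval_expCurve hN, expCurve_eq_zero hN hNH hp, Polynomial.eval_zero]

lemma mem_lieAlg_of_expGL_mem {H : Subgroup (GL (Fin n) K)} {N : Matrix (Fin n) (Fin n) K}
    (hN : IsNilpotent N) (h : ∀ t : K, expGL (t • N) (hN.smul t) ∈ H) : N ∈ lieAlg H := by
  refine mem_lieAlg_iff_eval_one.2 fun p hp => ?_
  have h0 : expCurve N p = 0 := Polynomial.funext fun t => by
    rw [eval_expCurve hN, Polynomial.eval_zero]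
    exact hp _ (h t)
  rw [← expGL_zero_smul N hN, ← eval_expCurve hN, ← derivative_expCurve hN, h0, map_zero,
    Polynomial.eval_zero]

/-- A closed set containing all the powers of a unipotent element contains the one-parameter
subgroup through it. -/
lemma IsZClosed.expGL_smul_mem {s : Set (GL (Fin n) K)} (hs : IsZClosed s)
    {N : Matrix (Fin n) (Fin n) K} (hN : IsNilpotent N) (h : ∀ k : ℕ, expGL N hN ^ k ∈ s) (t : K) :
    expGL (t • N) (hN.smul t) ∈ s :=
  hs.mem_of_forall_eval fun p hp => by
    have h0 : expCurve N p = 0 := by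
      refine Polynomial.eq_zero_of_infinite_isRoot _
        ((Set.infinite_range_of_injective (Nat.cast_injective (R := K))).mono ?_)
      rintro _ ⟨k, rfl⟩
      change Polynomial.eval _ _ = 0
      rw [eval_expCurve hN, expGL_natCast_smul N hN]
      exact hp _ (h k)
    rw [← eval_expCurve hN, h0, Polynomial.eval_zero]

lemma exists_expGL_eq {u : GL (Fin n) K} (hu : IsNilpotent ((u : Matrix (Fin n) (Fin n) K) - 1)) :
    ∃ N, ∃ hN : IsNilpotent N, expGL N hN = u := by
  obtain ⟨N, hN, h⟩ := IsNilpotent.exists_exp_eq_one_add (K := K) hu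
  exact ⟨N, hN, Units.ext (by rw [expGL_val, h, add_sub_cancel])⟩

end Exponential

section AdditiveCharacter

attribute [local instance] LieRing.ofAssociativeRing

open Module.End

variable {n : ℕ}

/-- A polynomial function that is additive on a subgroup. -/
def IsAdditiveOn (H : Subgroup (GL (Fin n) K)) (F : MatPoly n K) : Prop :=
  ∀ A ∈ H, ∀ B ∈ H, eval (matOf (A * B)) F = eval (matOf A) F + eval (matOf B) F

/-- The differential at the identity of a polynomial function. -/
noncomputable def differential (F : MatPoly n K) : Matrix (Fin n) (Fin n) K →ₗ[K] K where
  toFun Z := eval (matOf 1) (lieDeriv Z F)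
  map_add' Y Z := by rw [lieDeriv_add, Derivation.add_apply, map_add]
  map_smul' c Z := by
    rw [lieDeriv_smul, Derivation.smul_apply, smul_eval, RingHom.id_apply, smul_eq_mul]

lemma lieDeriv_C (Z : Matrix (Fin n) (Fin n) K) (c : K) : lieDeriv Z (C c) = 0 :=
  Derivation.map_algebraMap (lieDeriv Z) c

namespace IsAdditiveOn

variable {H : Subgroup (GL (Fin n) K)} {F : MatPoly n K}

lemma eval_one (hF : IsAdditiveOn H F) : eval (matOf 1) F = 0 := by
  have := hF 1 H.one_mem 1 H.one_mem
  rw [mul_one] at this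
  simpa using this

lemma eval_lieDeriv (hF : IsAdditiveOn H F) {A : GL (Fin n) K} (hA : A ∈ H)
    {Z : Matrix (Fin n) (Fin n) K} (hZ : Z ∈ lieAlg H) :
    eval (matOf A) (lieDeriv Z F) = differential F Z := by
  have hp : leftTranslate A F - F - C (eval (matOf A) F) ∈
      vanishing (H : Set (GL (Fin n) K)) := fun B hB => by
    rw [map_sub, map_sub, eval_C, eval_leftTranslate, hF A hA B hB]
    ring
  have := hZ _ hp 1 H.one_mem
  rwa [map_sub, map_sub, lieDeriv_C, map_zero, sub_zero, map_sub, map_sub, ← leftTranslate_lieDeriv,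
    eval_leftTranslate, mul_one, sub_eq_zero] at this

lemma lieDeriv_sub_mem (hF : IsAdditiveOn H F) {Z : Matrix (Fin n) (Fin n) K}
    (hZ : Z ∈ lieAlg H) :
    lieDeriv Z F - C (differential F Z) ∈ vanishing (H : Set (GL (Fin n) K)) := fun A hA => by
  rw [map_sub, hF.eval_lieDeriv hA hZ, eval_C, sub_self]

lemma differential_conj (hF : IsAdditiveOn H F) {A : GL (Fin n) K} (hA : A ∈ H)
    {Z : Matrix (Fin n) (Fin n) K} (hZ : Z ∈ lieAlg H) :
    differential F ((A : Matrix (Fin n) (Fin n) K) * Z * (A⁻¹ : GL (Fin n) K).val) =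
      differential F Z := by
  have hp : rightTranslate A F - F - C (eval (matOf A) F) ∈
      vanishing (H : Set (GL (Fin n) K)) := fun B hB => by
    rw [map_sub, map_sub, eval_C, eval_rightTranslate, hF B hB A hA]
    ring
  have := conj_mem_lieAlg hA hZ _ hp 1 H.one_mem
  rw [map_sub, map_sub, lieDeriv_C, map_zero, sub_zero, map_sub, map_sub, ← rightTranslate_lieDeriv,
    eval_rightTranslate, one_mul, hF.eval_lieDeriv hA hZ, sub_eq_zero] at this
  exact this.symm

lemma eval_expGL [CharZero K] (hF : IsAdditiveOn H F) {N : Matrix (Fin n) (Fin n) K}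
    (hN : IsNilpotent N) (hNH : N ∈ lieAlg H) :
    eval (matOf (expGL N hN)) F = differential F N := by
  have h0 := expCurve_eq_zero hN hNH (hF.lieDeriv_sub_mem hNH)
  rw [map_sub, ← derivative_expCurve hN, sub_eq_zero, ← algebraMap_eq, AlgHom.commutes,
    Polynomial.algebraMap_eq] at h0
  have h1 : Polynomial.derivative
      (expCurve N F - Polynomial.C (differential F N) * Polynomial.X) = 0 := by
    rw [Polynomial.derivative_sub, h0, Polynomial.derivative_C_mul, Polynomial.derivative_X,
      mul_one, sub_self]
  have h2 := Polynomial.eq_C_of_derivative_eq_zero h1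
  have h3 := congrArg (Polynomial.eval 0) h2
  have h4 := congrArg (Polynomial.eval 1) h2
  simp only [Polynomial.eval_sub, Polynomial.eval_mul, Polynomial.eval_C, Polynomial.eval_X,
    mul_zero, mul_one, sub_zero, eval_expCurve hN, expGL_zero_smul N hN, hF.eval_one] at h3 h4
  rw [← h3, sub_eq_zero] at h4
  simpa only [one_smul] using h4

lemma differential_conjDiag (hF : IsAdditiveOn H F) {g : GL (Fin n) K} {d : Fin n → K}
    (h : conjDiag g d ∈ lieAlg H) : differential F (conjDiag g d) = 0 := by
  obtain ⟨Φ, hΦ⟩ : ∃ Φ : Module.End K (MatPoly n K),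
      Φ = (lieDeriv (conjDiag g d) : MatPoly n K →ₗ[K] MatPoly n K) := ⟨_, rfl⟩
  have hI : ∀ p ∈ vanishing (H : Set (GL (Fin n) K)), Φ p ∈ vanishing (H : Set (GL (Fin n) K)) :=
    hΦ ▸ h
  have hE : ∀ v : K, eigenspace Φ v ≤ Φ.maxGenEigenspace (id v) := fun v =>
    (Φ.genEigenspace _).monotone le_top
  have htop : ⨆ v, eigenspace Φ v = ⊤ := by
    rw [hΦ]
    exact iSup_eigenspace_lieDeriv g d
  have hΨ : ∀ v : K, ∀ p ∈ eigenspace Φ v, Φ p = id v • p := fun v p hp => mem_eigenspace_iff.1 hp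
  have he : (C (differential F (conjDiag g d)) : MatPoly n K) ∈ eigenspace Φ 0 := by
    rw [mem_eigenspace_iff, zero_smul, hΦ]
    exact lieDeriv_C _ _
  have hp : Φ F - C (differential F (conjDiag g d)) ∈ vanishing (H : Set (GL (Fin n) K)) :=
    hΦ ▸ hF.lieDeriv_sub_mem h
  have := mem_of_apply_sub_mem hI Function.injective_id hE htop hΨ rfl he hp 1 H.one_mem
  rwa [eval_C] at this

lemma eval_conjDiagGL (hF : IsAdditiveOn H F) {g : GL (Fin n) K} {d : Fin n → Kˣ}
    (h : conjDiagGL g d ∈ H) : eval (matOf (conjDiagGL g d)) F = 0 := by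
  obtain ⟨Φ, hΦ⟩ : ∃ Φ : Module.End K (MatPoly n K),
      Φ = (rightTranslate (conjDiagGL g d)).toLinearMap := ⟨_, rfl⟩
  let χ : Additive Kˣ → K := fun v => ((v.toMul : Kˣ) : K)
  have hI : ∀ p ∈ vanishing (H : Set (GL (Fin n) K)), Φ p ∈ vanishing (H : Set (GL (Fin n) K)) :=
    hΦ ▸ fun p hp => rightTranslate_mem_vanishing h hp
  have hχ : Function.Injective χ := Units.val_injective.comp Additive.toMul.injective
  have hE : ∀ v, eigenspace Φ (χ v) ≤ Φ.maxGenEigenspace (χ v) := fun v =>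
    (Φ.genEigenspace _).monotone le_top
  have htop : ⨆ v, eigenspace Φ (χ v) = ⊤ := by
    rw [hΦ]
    exact iSup_eigenspace_rightTranslate g d
  have hΨ : ∀ v, ∀ p ∈ eigenspace Φ (χ v), (Φ - 1 : Module.End K (MatPoly n K)) p = (χ v - 1) • p :=
    fun v p hp => by
      rw [LinearMap.sub_apply, mem_eigenspace_iff.1 hp, Module.End.one_apply, sub_smul, one_smul]
  have h₀ : χ 0 - 1 = 0 := by simp [χ]
  have he : (C (eval (matOf (conjDiagGL g d)) F) : MatPoly n K) ∈ eigenspace Φ (χ 0) := by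
    rw [mem_eigenspace_iff, sub_eq_zero.1 h₀, one_smul, ← algebraMap_eq]
    rw [hΦ]
    exact AlgHom.commutes (rightTranslate (conjDiagGL g d)) _
  have hp : (Φ - 1 : Module.End K (MatPoly n K)) F - C (eval (matOf (conjDiagGL g d)) F) ∈
      vanishing (H : Set (GL (Fin n) K)) := fun A hA => by
    have : eval (matOf A) (Φ F) = eval (matOf (A * conjDiagGL g d)) F := by
      rw [hΦ, AlgHom.toLinearMap_apply, eval_rightTranslate]
    rw [LinearMap.sub_apply, map_sub, map_sub, this, Module.End.one_apply, eval_C, hF A hA _ h]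
    ring
  have := mem_of_apply_sub_mem hI hχ hE htop hΨ h₀ he hp 1 H.one_mem
  rwa [eval_C] at this

/-- A nonzero additive character has a nonzero differential. -/
lemma exists_differential_ne_zero [IsAlgClosed K] [CharZero K]
    (hF : IsAdditiveOn H F) (hH : IsZClosed (H : Set (GL (Fin n) K))) {u : GL (Fin n) K}
    (hu : u ∈ H) (hFu : eval (matOf u) F ≠ 0) :
    ∃ N ∈ lieAlg H, differential F N ≠ 0 := by
  obtain ⟨g, d, m, hud, hm, hc⟩ := exists_conjDiag_add_nilpotent (u : Matrix (Fin n) (Fin n) K)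
  have hcu : Commute (u : Matrix (Fin n) (Fin n) K) (conjDiag g d) := hc _ (Commute.refl _)
  have hmd : Commute m (conjDiag g d) := by
    rw [hud] at hcu
    simpa using hcu.sub_left (Commute.refl (conjDiag g d))
  have hmu : Commute m (u : Matrix (Fin n) (Fin n) K) := by
    rw [hud]
    exact hmd.add_right (Commute.refl m)
  have hs : IsUnit (conjDiag g d) := by
    have : conjDiag g d = u + -m := by rw [hud, add_neg_cancel_right]
    rw [this]
    exact hm.neg.isUnit_add_left_of_commute u.isUnit hmu.neg_left
  have hd : ∀ k, d k ≠ 0 := by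
    have h1 := (Matrix.isUnit_iff_isUnit_det _).1 hs
    rw [conjDiag, det_mul_right_comm, GL_val_mul_val_inv, one_mul, det_diagonal,
      isUnit_iff_ne_zero, Finset.prod_ne_zero_iff] at h1
    exact fun k => h1 k (Finset.mem_univ k)
  set s := conjDiagGL g (fun k => Units.mk0 (d k) (hd k)) with hsdef
  have hsv : (s : Matrix (Fin n) (Fin n) K) = conjDiag g d := rfl
  have hsH : s ∈ H := conjDiagGL_mem hH hu hm hud hmd
  have hvH : s⁻¹ * u ∈ H := H.mul_mem (H.inv_mem hsH) hu
  have hv : IsNilpotent ((s⁻¹ * u : GL (Fin n) K).val - 1) := by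
    rw [Units.val_mul, hud, mul_add, ← hsv, GL_val_inv_mul_val, add_sub_cancel_left]
    exact (hmd.units_inv_right (u := s)).symm.isNilpotent_mul_left hm
  obtain ⟨N, hN, hNv⟩ := exists_expGL_eq hv
  have hNH : N ∈ lieAlg H := mem_lieAlg_of_expGL_mem hN fun t =>
    hH.expGL_smul_mem hN (fun k => by rw [hNv]; exact H.pow_mem hvH k) t
  refine ⟨N, hNH, ?_⟩
  rw [← hF.eval_expGL hN hNH, hNv]
  have := hF s hsH _ hvH
  rw [mul_inv_cancel_left, hF.eval_conjDiagGL hsH, zero_add] at this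
  rwa [← this]

end IsAdditiveOn

/-- An invariant linear form under commuting diagonalizable elements that vanishes on the
fixed points vanishes. -/
lemma eq_zero_of_conj_invariant [IsAlgClosed K] {T : Set (GL (Fin n) K)}
    (hT : ∀ t ∈ T, ∃ g d, t = conjDiagGL g d) (hTc : ∀ t ∈ T, ∀ t' ∈ T, Commute t t')
    {W : Submodule K (Matrix (Fin n) (Fin n) K)}
    (hW : ∀ t ∈ T, ∀ Y ∈ W, (t : Matrix (Fin n) (Fin n) K) * Y * (t⁻¹ : GL (Fin n) K).val ∈ W)
    {φ : Matrix (Fin n) (Fin n) K →ₗ[K] K}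
    (hφ : ∀ t ∈ T, ∀ Y ∈ W,
      φ ((t : Matrix (Fin n) (Fin n) K) * Y * (t⁻¹ : GL (Fin n) K).val) = φ Y)
    (hfix : ∀ Y ∈ W, (∀ t ∈ T, Commute Y (t : Matrix (Fin n) (Fin n) K)) → φ Y = 0) :
    ∀ Y ∈ W, φ Y = 0 := by
  let Ad (t : T) : Module.End K W := (LinearMap.mulLeftRight K
    ((t : GL (Fin n) K).val, ((t : GL (Fin n) K)⁻¹ : GL (Fin n) K).val)).restrict
    (fun Y hY => hW t t.2 Y hY)
  have hAd : ∀ (t : T) (Y : W), ((Ad t Y : W) : Matrix (Fin n) (Fin n) K) =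
    (t : GL (Fin n) K).val * Y * ((t : GL (Fin n) K)⁻¹ : GL (Fin n) K).val := fun _ _ => rfl
  have htop := iSup_iInf_maxGenEigenspace_eq_top_of_iSup_maxGenEigenspace_eq_top_of_commute
    Ad (fun t t' _ => LinearMap.ext fun Y => Subtype.ext (by
      have h1 := congrArg Units.val (hTc t t.2 t' t'.2).eq
      have h2 := congrArg Units.val ((hTc t t.2 t' t'.2).symm.inv_inv).eq
      rw [Units.val_mul, Units.val_mul] at h1 h2
      rw [Module.End.mul_apply, Module.End.mul_apply, hAd, hAd, hAd, hAd]
      calc _ = ((t : GL (Fin n) K).val * (t' : GL (Fin n) K).val) * Y.1 *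
            (((t' : GL (Fin n) K)⁻¹ : GL (Fin n) K).val *
              ((t : GL (Fin n) K)⁻¹ : GL (Fin n) K).val) := by simp only [mul_assoc]
        _ = _ := by rw [h1, h2]; simp only [mul_assoc]))
    (fun t => iSup_maxGenEigenspace_eq_top _)
  have hle : ⨆ χ : T → K, ⨅ t, (Ad t).maxGenEigenspace (χ t) ≤
      LinearMap.ker (φ ∘ₗ W.subtype) := by
    refine iSup_le fun χ Y hY => ?_
    rw [Submodule.mem_iInf] at hY
    have heig : ∀ t : T, (t : GL (Fin n) K).val * Y.1 *
        ((t : GL (Fin n) K)⁻¹ : GL (Fin n) K).val = χ t • Y.1 := by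
      intro t
      obtain ⟨g, d, htd⟩ := hT t t.2
      refine congrArg Subtype.val (eq_smul_of_mem_maxGenEigenspace
        (fun q : Fin n × Fin n => entryLinearMap K K q.1 q.2 ∘ₗ LinearMap.mulLeftRight K
          ((g⁻¹ : GL (Fin n) K).val, (g : Matrix (Fin n) (Fin n) K)) ∘ₗ W.subtype)
        (fun Y hY => ?_) (fun q => (d q.1 : K) * ((d q.2)⁻¹ : Kˣ)) (fun q Y => ?_) (hY t))
      · have h0 : (g⁻¹ : GL (Fin n) K).val * Y.1 * (g : Matrix (Fin n) (Fin n) K) = 0 :=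
          Matrix.ext fun i j => hY (i, j)
        apply Subtype.ext
        calc Y.1 = (g : Matrix (Fin n) (Fin n) K) * ((g⁻¹ : GL (Fin n) K).val * Y.1 *
              (g : Matrix (Fin n) (Fin n) K)) * (g⁻¹ : GL (Fin n) K).val := by
              rw [← mul_assoc, ← mul_assoc, GL_val_mul_val_inv, one_mul, mul_assoc,
                GL_val_mul_val_inv, mul_one]
          _ = 0 := by rw [h0, mul_zero, zero_mul]
      · change ((g⁻¹ : GL (Fin n) K).val * ((t : GL (Fin n) K).val * Y.1 *
          ((t : GL (Fin n) K)⁻¹ : GL (Fin n) K).val) * (g : Matrix (Fin n) (Fin n) K)) q.1 q.2 =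
          _ * ((g⁻¹ : GL (Fin n) K).val * Y.1 * (g : Matrix (Fin n) (Fin n) K)) q.1 q.2
        rw [htd, conjDiagGL_val, conjDiagGL_inv_val, conjDiag, conjDiag]
        have : (g⁻¹ : GL (Fin n) K).val * ((g : Matrix (Fin n) (Fin n) K) *
            diagonal (fun k => (d k : K)) * (g⁻¹ : GL (Fin n) K).val * Y.1 *
            ((g : Matrix (Fin n) (Fin n) K) * diagonal (fun k => (((d k)⁻¹ : Kˣ) : K)) *
              (g⁻¹ : GL (Fin n) K).val)) * (g : Matrix (Fin n) (Fin n) K) =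
            diagonal (fun k => (d k : K)) * ((g⁻¹ : GL (Fin n) K).val * Y.1 *
              (g : Matrix (Fin n) (Fin n) K)) * diagonal (fun k => (((d k)⁻¹ : Kˣ) : K)) := by
          simp only [mul_assoc, GL_val_inv_mul_val, mul_one]
          rw [← mul_assoc _ (g : Matrix (Fin n) (Fin n) K), GL_val_inv_mul_val, one_mul]
        rw [this, mul_diagonal, diagonal_mul]
        ring
    change φ Y.1 = 0
    by_cases hχ : ∀ t, χ t = 1
    · refine hfix _ Y.2 fun t ht => ?_
      have := heig ⟨t, ht⟩
      rw [hχ, one_smul] at this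
      calc Y.1 * (t : Matrix (Fin n) (Fin n) K) = (t : Matrix (Fin n) (Fin n) K) * Y.1 *
            ((t⁻¹ : GL (Fin n) K).val * (t : Matrix (Fin n) (Fin n) K)) := by
            conv_lhs => rw [← this]
            rw [mul_assoc]
        _ = _ := by rw [GL_val_inv_mul_val, mul_one]
    · push Not at hχ
      obtain ⟨t, ht⟩ := hχ
      have h1 := hφ t t.2 Y.1 Y.2
      rw [heig, map_smul, smul_eq_mul] at h1
      have h2 : (χ t - 1) * φ Y.1 = 0 := by rw [sub_mul, h1, one_mul, sub_self]
      exact (mul_eq_zero.1 h2).resolve_left (sub_ne_zero.2 ht)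
  intro Y hY
  exact hle (htop ▸ Submodule.mem_top : (⟨Y, hY⟩ : W) ∈ _)

end AdditiveCharacter

section TorusMaximality

variable {n : ℕ}

/-- A curve parametrized by polynomials up to nonvanishing factors is irreducible. -/
lemma forall_mem_or_forall_mem_of_curve {ι : Type*} {γ : ι → GL (Fin n) K} {ε : ι → K}
    (hε : (Set.range ε).Infinite)
    (hγ : ∀ p : MatPoly n K, ∃ h : Polynomial K, ∀ c, eval (matOf (γ c)) p = 0 ↔ h.eval (ε c) = 0)
    {s t : Set (GL (Fin n) K)} (hs : IsZClosed s) (ht : IsZClosed t)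
    (hst : ∀ c, γ c ∈ s ∨ γ c ∈ t) : (∀ c, γ c ∈ s) ∨ ∀ c, γ c ∈ t := by
  by_contra! ⟨⟨c₁, h₁⟩, c₂, h₂⟩
  obtain ⟨I, rfl⟩ := hs
  obtain ⟨J, rfl⟩ := ht
  simp only [Set.mem_ofPred_eq, not_forall] at h₁ h₂
  obtain ⟨p, hp, hp₁⟩ := h₁
  obtain ⟨q, hq, hq₂⟩ := h₂
  obtain ⟨h, hh⟩ := hγ p
  obtain ⟨k, hk⟩ := hγ q
  have hzero : h * k = 0 := by
    refine Polynomial.eq_zero_of_infinite_isRoot _ (hε.mono ?_)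
    rintro _ ⟨c, rfl⟩
    rw [Set.mem_ofPred_eq, Polynomial.IsRoot, Polynomial.eval_mul, mul_eq_zero, ← hh, ← hk]
    exact (hst c).imp (fun h => h p hp) (fun h => h q hq)
  rcases mul_eq_zero.1 hzero with h0 | h0
  · exact hp₁ ((hh c₁).2 (by rw [h0, Polynomial.eval_zero]))
  · exact hq₂ ((hk c₂).2 (by rw [h0, Polynomial.eval_zero]))

/-- The functions on `Kˣ` given by Laurent polynomials. -/
def laurentFun (K : Type) [Field K] : Subalgebra K (Kˣ → K) where
  carrier := {φ | ∃ (N : ℕ) (h : Polynomial K), ∀ c : Kˣ, (c : K) ^ N * φ c = h.eval (c : K)}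
  mul_mem' := by
    rintro φ ψ ⟨N, h, hh⟩ ⟨M, k, hk⟩
    refine ⟨N + M, h * k, fun c => ?_⟩
    rw [Polynomial.eval_mul, ← hh, ← hk, pow_add, Pi.mul_apply]
    ring
  add_mem' := by
    rintro φ ψ ⟨N, h, hh⟩ ⟨M, k, hk⟩
    refine ⟨N + M, h * Polynomial.X ^ M + k * Polynomial.X ^ N, fun c => ?_⟩
    rw [Polynomial.eval_add, Polynomial.eval_mul, Polynomial.eval_mul, ← hh, ← hk, pow_add,
      Pi.add_apply, Polynomial.eval_pow, Polynomial.eval_pow, Polynomial.eval_X]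
    ring
  algebraMap_mem' a := ⟨0, Polynomial.C a, fun c => by simp⟩

lemma zpow_mem_laurentFun (a : ℤ) : (fun c : Kˣ => ((c ^ a : Kˣ) : K)) ∈ laurentFun K := by
  obtain ⟨N, rfl | rfl⟩ := a.eq_nat_or_neg
  · exact ⟨0, Polynomial.X ^ N, fun c => by simp⟩
  · exact ⟨N, 1, fun c => by simp⟩

lemma eval_mem_laurentFun {γ : Kˣ → GL (Fin n) K}
    (h : ∀ i j, (fun c => (γ c : Matrix (Fin n) (Fin n) K) i j) ∈ laurentFun K)
    (h' : ∀ i j, (fun c => ((γ c)⁻¹ : GL (Fin n) K).val i j) ∈ laurentFun K) (p : MatPoly n K) :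
    (fun c => eval (matOf (γ c)) p) ∈ laurentFun K := by
  induction p using MvPolynomial.induction_on with
  | C a =>
    simp only [eval_C]
    exact (laurentFun K).algebraMap_mem a
  | add p q hp hq =>
    simp only [map_add]
    exact add_mem hp hq
  | mul_X p q hp =>
    simp only [map_mul, eval_X]
    refine mul_mem hp ?_
    rcases q with q | q
    · exact h _ _
    · exact h' _ _

lemma mul_mem_laurentFun (A : Matrix (Fin n) (Fin n) K) {B : Kˣ → Matrix (Fin n) (Fin n) K}
    (h : ∀ i j, (fun c => B c i j) ∈ laurentFun K) (i j : Fin n) :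
    (fun c => (A * B c) i j) ∈ laurentFun K := by
  have : (fun c => (A * B c) i j) = ∑ k, A i k • fun c => B c k j := by
    ext c
    simp [mul_apply]
  rw [this]
  exact sum_mem fun k _ => (laurentFun K).smul_mem (h k j) _

lemma mul_mem_laurentFun' (A : Matrix (Fin n) (Fin n) K) {B : Kˣ → Matrix (Fin n) (Fin n) K}
    (h : ∀ i j, (fun c => B c i j) ∈ laurentFun K) (i j : Fin n) :
    (fun c => (B c * A) i j) ∈ laurentFun K := by
  have : (fun c => (B c * A) i j) = ∑ k, A k j • fun c => B c i k := by
    ext c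
    simp [mul_apply, mul_comm]
  rw [this]
  exact sum_mem fun k _ => (laurentFun K).smul_mem (h i k) _

lemma conjDiag_zpow_mem_laurentFun (g : GL (Fin n) K) (a : Fin n → ℤ) (i j : Fin n) :
    (fun c : Kˣ => conjDiag g (fun k => ((c ^ a k : Kˣ) : K)) i j) ∈ laurentFun K := by
  refine mul_mem_laurentFun' _ (mul_mem_laurentFun _ fun k l => ?_) i j
  by_cases hkl : k = l
  · subst hkl
    simpa only [diagonal_apply_eq] using zpow_mem_laurentFun (a k)
  · simp only [diagonal_apply_ne _ hkl]
    exact zero_mem _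

lemma exists_polynomial_mul_conjDiagGL (A g : GL (Fin n) K) (a : Fin n → ℤ) (p : MatPoly n K) :
    ∃ h : Polynomial K, ∀ c : Kˣ,
      eval (matOf (A * conjDiagGL g fun k => c ^ a k)) p = 0 ↔ h.eval (c : K) = 0 := by
  obtain ⟨N, h, hh⟩ := eval_mem_laurentFun (γ := fun c => A * conjDiagGL g fun k => c ^ a k)
    (mul_mem_laurentFun A.val (conjDiag_zpow_mem_laurentFun g a))
    (fun i j => by
      simp only [_root_.mul_inv_rev, Units.val_mul, conjDiagGL_inv_val]
      refine mul_mem_laurentFun' _ (fun i j => ?_) i j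
      simpa only [← _root_.zpow_neg] using conjDiag_zpow_mem_laurentFun g (fun k => -a k) i j) p
  refine ⟨h, fun c => ?_⟩
  rw [← hh, mul_eq_zero, or_iff_right (pow_ne_zero _ c.ne_zero)]

lemma isZClosed_setOf_linear {ι : Type*} (φ : ι → Matrix (Fin n) (Fin n) K →ₗ[K] K) (b : ι → K) :
    IsZClosed {A : GL (Fin n) K | ∀ i, φ i A.val = b i} := by
  refine ⟨Set.range fun i => (∑ k, ∑ l, C (φ i (Matrix.single k l 1)) * X (Sum.inl (k, l))) -
    C (b i), ?_⟩
  ext A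
  simp only [Set.mem_ofPred_eq, Set.forall_mem_range]
  refine forall_congr' fun i => ?_
  simp only [map_sub, map_sum, map_mul, eval_C, eval_X, sub_eq_zero]
  have : φ i A.val = ∑ k, ∑ l, φ i (Matrix.single k l 1) * A.val k l := by
    conv_lhs => rw [matrix_eq_sum_single A.val]
    simp only [map_sum]
    refine Finset.sum_congr rfl fun k _ => Finset.sum_congr rfl fun l _ => ?_
    have : Matrix.single k l (A.val k l) = A.val k l • Matrix.single k l (1 : K) := by
      rw [smul_single, smul_eq_mul, mul_one]
    rw [this, map_smul, smul_eq_mul, mul_comm]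
  rw [this]
  rfl

/-- The Zariski closure of a subgroup is a subgroup. -/
def zClosureSubgroup (M : Subgroup (GL (Fin n) K)) : Subgroup (GL (Fin n) K) where
  carrier := zClosure M
  one_mem' := subset_zClosure _ M.one_mem
  mul_mem' := fun {A B} hA hB p hp => by
    rw [← eval_rightTranslate]
    refine hA _ fun C hC => ?_
    rw [eval_rightTranslate, ← eval_leftTranslate]
    exact hB _ (leftTranslate_mem_vanishing hC hp)
  inv_mem' := fun {A} hA p hp => by
    have h : ∀ B : GL (Fin n) K, eval (matOf B) (rename Sum.swap p) = eval (matOf B⁻¹) p := by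
      intro B
      rw [eval_rename]
      congr 2
      ext (q | q)
      · rfl
      · simp [matOf]
    rw [← h]
    refine hA _ fun B hB => ?_
    rw [h]
    exact hp _ (M.inv_mem hB)

lemma eq_conjDiagGL_of_val_eq {A g : GL (Fin n) K} {d : Fin n → K}
    (h : (A : Matrix (Fin n) (Fin n) K) = conjDiag g d) : ∃ d' : Fin n → Kˣ, A = conjDiagGL g d' := by
  have hd : ∀ k, d k ≠ 0 := by
    have h1 := (Matrix.isUnit_iff_isUnit_det _).1 A.isUnit
    rw [h, conjDiag, det_mul_right_comm, GL_val_mul_val_inv, one_mul, det_diagonal,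
      isUnit_iff_ne_zero, Finset.prod_ne_zero_iff] at h1
    exact fun k => h1 k (Finset.mem_univ k)
  exact ⟨fun k => Units.mk0 (d k) (hd k), Units.ext h⟩

lemma IsTorus.exists_conjDiagGL [IsAlgClosed K] {T : Subgroup (GL (Fin n) K)} (hT : IsTorus T) :
    ∃ g : GL (Fin n) K, ∀ A ∈ T, ∃ d, A = conjDiagGL g d := by
  obtain ⟨-, -, g', hg'⟩ := hT
  let e : K ≃+* AlgebraicClosure K := RingEquiv.ofBijective (algebraMap K (AlgebraicClosure K))
    IsAlgClosed.algebraMap_bijective_of_isIntegral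
  let g : GL (Fin n) K := Units.map e.symm.toRingHom.mapMatrix.toMonoidHom g'
  have hg : glBaseChange g = g' := by
    ext i j
    exact e.apply_symm_apply _
  refine ⟨g⁻¹, fun A hA => ?_⟩
  have h1 := hg' A hA
  rw [← hg, ← map_mul, ← map_inv, ← map_mul] at h1
  have h2 : (g * A * g⁻¹).val.IsDiag := fun i j hij =>
    (map_eq_zero (algebraMap K (AlgebraicClosure K))).1 (h1 hij)
  refine eq_conjDiagGL_of_val_eq (d := (g * A * g⁻¹).val.diag) ?_
  rw [conjDiag, inv_inv, h2.diagonal_diag, ← Units.val_mul, ← Units.val_mul]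
  congr 1
  group

lemma isTorus_of_conjDiag {T : Subgroup (GL (Fin n) K)} (hcl : IsZClosed (T : Set (GL (Fin n) K)))
    (hcon : IsConnectedSG T) {g : GL (Fin n) K}
    (hg : ∀ A ∈ T, ((g⁻¹ : GL (Fin n) K).val * A.val * g.val).IsDiag) : IsTorus T := by
  refine ⟨hcl, hcon, glBaseChange g⁻¹, fun A hA i j hij => ?_⟩
  rw [← map_mul, ← map_inv, inv_inv, ← map_mul]
  exact (congrArg (algebraMap K (AlgebraicClosure K)) (hg A hA hij)).trans (map_zero _)

lemma conjDiagGL_mul (g : GL (Fin n) K) (d d' : Fin n → Kˣ) :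
    conjDiagGL g d * conjDiagGL g d' = conjDiagGL g (d * d') :=
  Units.ext (conjDiag_mul g _ _)

lemma conjDiagGL_one (g : GL (Fin n) K) : conjDiagGL g 1 = 1 := Units.ext (conjDiag_one g)

lemma conjDiagGL_commute (g : GL (Fin n) K) (d d' : Fin n → Kˣ) :
    Commute (conjDiagGL g d) (conjDiagGL g d') := by
  rw [commute_iff_eq, conjDiagGL_mul, conjDiagGL_mul, mul_comm]

/-- The cocharacter with weights `a` in the basis given by `g`. -/
noncomputable def cochar (g : GL (Fin n) K) (a : Fin n → ℤ) : Kˣ →* GL (Fin n) K where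
  toFun c := conjDiagGL g fun k => c ^ a k
  map_one' := by simp only [_root_.one_zpow]; exact conjDiagGL_one g
  map_mul' c c' := by
    rw [conjDiagGL_mul]
    congr 1
    ext k
    rw [_root_.mul_zpow, Pi.mul_apply]

lemma cochar_apply (g : GL (Fin n) K) (a : Fin n → ℤ) (c : Kˣ) :
    cochar g a c = conjDiagGL g fun k => c ^ a k := rfl

/-- A maximal torus contains the cocharacters of the group commuting with it. -/
lemma IsMaximalTorus.cochar_mem [IsAlgClosed K] {G T : Subgroup (GL (Fin n) K)}
    (hT : IsMaximalTorus G T) (hG : IsZClosed (G : Set (GL (Fin n) K))) {g : GL (Fin n) K}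
    {a : Fin n → ℤ} (ha : ∀ c, cochar g a c ∈ G) (hc : ∀ t ∈ T, ∀ c, Commute t (cochar g a c))
    (c : Kˣ) : cochar g a c ∈ T := by
  let M : Subgroup (GL (Fin n) K) :=
    { carrier := {B | ∃ t ∈ T, ∃ c, B = t * cochar g a c}
      one_mem' := ⟨1, T.one_mem, 1, by rw [map_one, mul_one]⟩
      mul_mem' := by
        rintro _ _ ⟨t, ht, c, rfl⟩ ⟨t', ht', c', rfl⟩
        refine ⟨t * t', T.mul_mem ht ht', c * c', ?_⟩
        rw [map_mul, mul_assoc, ← mul_assoc _ t', ← (hc t' ht' c).eq]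
        simp only [mul_assoc]
      inv_mem' := by
        rintro _ ⟨t, ht, c, rfl⟩
        refine ⟨t⁻¹, T.inv_mem ht, c⁻¹, ?_⟩
        rw [_root_.mul_inv_rev, map_inv, ((hc t ht c).inv_inv).eq] }
  have hM : ∀ {B}, B ∈ M ↔ ∃ t ∈ T, ∃ c, B = t * cochar g a c := Iff.rfl
  have hTM : T ≤ M := fun t ht => ⟨t, ht, 1, by rw [map_one, mul_one]⟩
  have hMG : M ≤ G := by
    rintro _ ⟨t, ht, c, rfl⟩
    exact G.mul_mem (hT.2.1 ht) (ha c)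
  obtain ⟨g₁, hg₁⟩ := hT.1.exists_conjDiagGL
  obtain ⟨g₂, hg₂⟩ := exists_simultaneous_conjDiag
    (fun x : T ⊕ Kˣ => (Sum.elim (fun t => t.1.val) (fun c => (cochar g a c).val) x :
      Matrix (Fin n) (Fin n) K))
    (by
      rintro (t | c)
      · obtain ⟨d, hd⟩ := hg₁ t t.2
        exact ⟨g₁, _, congrArg Units.val hd⟩
      · exact ⟨g, _, rfl⟩)
    (by
      have hu : ∀ {x y : GL (Fin n) K}, Commute x y → Commute x.val y.val := fun h =>
        congrArg Units.val h.eq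
      rintro (t | c) (t' | c')
      · obtain ⟨d, hd⟩ := hg₁ t t.2
        obtain ⟨d', hd'⟩ := hg₁ t' t'.2
        refine hu ?_
        rw [hd, hd']
        exact conjDiagGL_commute _ _ _
      · exact hu (hc t t.2 c')
      · exact hu (hc t' t'.2 c).symm
      · exact hu (conjDiagGL_commute _ _ _))
  let D : Set (GL (Fin n) K) := {A | ∀ q : {q : Fin n × Fin n // q.1 ≠ q.2},
    (entryLinearMap K K q.1.1 q.1.2 ∘ₗ LinearMap.mulLeftRight K ((g₂⁻¹ : GL (Fin n) K).val, g₂.val))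
      A.val = 0}
  have hD : IsZClosed D := isZClosed_setOf_linear _ _
  have hMD : (M : Set (GL (Fin n) K)) ⊆ D := by
    rintro _ ⟨t, ht, c, rfl⟩ q
    obtain ⟨d, hd⟩ := hg₂ (Sum.inl ⟨t, ht⟩)
    obtain ⟨d', hd'⟩ := hg₂ (Sum.inr c)
    change ((g₂⁻¹ : GL (Fin n) K).val * (t.val * (cochar g a c).val) * g₂.val) q.1.1 q.1.2 = 0
    simp only [Sum.elim_inl, Sum.elim_inr] at hd hd'
    rw [hd, hd', conjDiag_mul, conjDiag, ← mul_assoc, ← mul_assoc, GL_val_inv_mul_val, one_mul,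
      mul_assoc, GL_val_inv_mul_val, mul_one, diagonal_apply_ne _ q.2]
  have hcon : IsConnectedSG (zClosureSubgroup M) := by
    intro s t hs ht hst hdisj
    have hMc : (M : Set (GL (Fin n) K)) ⊆ zClosureSubgroup M := subset_zClosure _
    have key : ∀ {s t : Set (GL (Fin n) K)}, IsZClosed s → IsZClosed t →
        (zClosureSubgroup M : Set (GL (Fin n) K)) ⊆ s ∪ t →
        (zClosureSubgroup M : Set (GL (Fin n) K)) ∩ s ∩ t = ∅ → (T : Set (GL (Fin n) K)) ⊆ s →
        (zClosureSubgroup M : Set (GL (Fin n) K)) ⊆ s := by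
      intro s t hs ht hst hdisj hTs
      refine hs.zClosure_subset ?_
      rintro _ ⟨A, hA, c, rfl⟩
      have hcurve := forall_mem_or_forall_mem_of_curve
        (γ := fun c => A * conjDiagGL g fun k => c ^ a k) (ε := fun c : Kˣ => (c : K))
        ((Set.finite_singleton (0 : K)).infinite_compl.mono fun x hx => ⟨Units.mk0 x hx, rfl⟩)
        (exists_polynomial_mul_conjDiagGL A g a) hs ht (fun c => hst (hMc ⟨A, hA, c, rfl⟩))
      rcases hcurve with h | h
      · exact h c
      · exfalso
        have h1 : A ∈ t := by
          have := h 1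
          rwa [← cochar_apply, map_one, mul_one] at this
        exact (Set.ext_iff.1 hdisj A).1 ⟨⟨hMc (hTM hA), hTs hA⟩, h1⟩
    have hTT : (T : Set (GL (Fin n) K)) ⊆ zClosureSubgroup M := fun A hA => hMc (hTM hA)
    rcases hT.1.2.1 s t hs ht (hTT.trans hst) (Set.subset_eq_empty (by
      exact Set.inter_subset_inter_left _ (Set.inter_subset_inter_left _ hTT)) hdisj) with h | h
    · exact Or.inl (key hs ht hst hdisj h)
    · exact Or.inr (key ht hs (by rwa [Set.union_comm])
        (by rwa [Set.inter_right_comm]) h)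
  have htor : IsTorus (zClosureSubgroup M) :=
    isTorus_of_conjDiag (isZClosed_zClosure _) hcon (g := g₂) fun A hA i j hij =>
      hD.zClosure_subset hMD hA ⟨(i, j), hij⟩
  have := hT.2.2 _ htor (hG.zClosure_subset hMG)
    (fun A hA => subset_zClosure _ (hTM hA))
  rw [← this]
  exact subset_zClosure _ (hM.2 ⟨1, T.one_mem, c, (one_mul _).symm⟩)

end TorusMaximality

section TraceForm

attribute [local instance] LieRing.ofAssociativeRing

variable {n : ℕ}

lemma conjDiag_eq_sum_smul {r : ℕ} (g : GL (Fin n) K) {d : Fin n → K} {a : Fin r → Fin n → ℤ}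
    {e : Fin r → K} (hd : ∀ k, d k = ∑ i, (a i k : K) * e i) :
    conjDiag g d = ∑ i, e i • conjDiag g fun k => (a i k : K) := by
  rw [← conjDiag_sum_smul]
  congr 1
  ext k
  simp [hd, mul_comm]

lemma int_coordinates_eq_of_eq [CharZero K] {r : ℕ} {d : Fin n → K} {a : Fin r → Fin n → ℤ}
    {e : Fin r → K} (he : LinearIndependent ℤ e) (hd : ∀ k, d k = ∑ i, (a i k : K) * e i)
    {j k : Fin n} (h : d j = d k) (i : Fin r) : a i j = a i k :=
  congrFun (sum_intCast_mul_injective (K := K) he (a₁ := fun i => a i j) (a₂ := fun i => a i k)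
    (by simpa only [hd] using h)) i

/-- The semisimple part of an element of the Lie algebra that commutes with a maximal torus
commutes with the centralizer of the torus. -/
lemma IsMaximalTorus.commute_conjDiag [IsAlgClosed K] [CharZero K] {G T : Subgroup (GL (Fin n) K)}
    (hT : IsMaximalTorus G T) (hG : IsZClosed (G : Set (GL (Fin n) K))) {g : GL (Fin n) K}
    {d : Fin n → K} {m : Matrix (Fin n) (Fin n) K} (hX : conjDiag g d + m ∈ lieAlg G)
    (hm : IsNilpotent m) (hc : Commute m (conjDiag g d))
    (hTd : ∀ t ∈ T, Commute t.val (conjDiag g d)) {Y : Matrix (Fin n) (Fin n) K}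
    (hY : ∀ t ∈ T, Commute Y t.val) : Commute Y (conjDiag g d) := by
  obtain ⟨r, a, e, he, hd⟩ := exists_int_coordinates d
  rw [conjDiag_eq_sum_smul g hd]
  refine Commute.sum_right _ _ _ fun i _ => Commute.smul_right ?_ _
  have hmem : ∀ c, cochar g (a i) c ∈ T := hT.cochar_mem hG
    (fun c => (_root_.cochar_mem hG hX hm hc he hd i).2 c)
    (fun t ht c => Units.ext ((hTd t ht).conjDiag_of_imp (d' := fun k => ((c ^ a i k : Kˣ) : K))
      (fun j k hjk => by rw [int_coordinates_eq_of_eq he hd hjk i])).eq)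
  refine (hY _ (hmem (Units.mk0 2 two_ne_zero))).conjDiag_of_imp fun j k hjk => ?_
  simp only [Units.val_zpow_eq_zpow_val, Units.val_mk0] at hjk
  have h2 : ((2 : ℚ) ^ a i j) = 2 ^ a i k := Rat.cast_injective (α := K) (by
    push_cast
    exact hjk)
  rw [zpow_right_injective₀ (by norm_num) (by norm_num) h2]

/-- The centralizer of a set of invertible matrices in the Lie algebra of a group. -/
def lieCentralizer (G : Subgroup (GL (Fin n) K)) (T : Set (GL (Fin n) K)) :
    LieSubalgebra K (Matrix (Fin n) (Fin n) K) where
  carrier := {Y | Y ∈ lieAlg G ∧ ∀ t ∈ T, Commute Y t.val}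
  add_mem' hY hZ := ⟨add_mem hY.1 hZ.1, fun t ht => (hY.2 t ht).add_left (hZ.2 t ht)⟩
  zero_mem' := ⟨zero_mem _, fun _ _ => Commute.zero_left _⟩
  smul_mem' c _ hY := ⟨(lieAlg G).smul_mem c hY.1, fun t ht => (hY.2 t ht).smul_left c⟩
  lie_mem' hY hZ := ⟨(lieAlg G).lie_mem hY.1 hZ.1, fun t ht =>
    ((hY.2 t ht).mul_left (hZ.2 t ht)).sub_left ((hZ.2 t ht).mul_left (hY.2 t ht))⟩

lemma commute_of_commute_add {m s : Matrix (Fin n) (Fin n) K} (h : Commute (s + m) s) :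
    Commute m s := by
  simpa using h.sub_left (Commute.refl s)

lemma IsMaximalTorus.isNilpotent_lieCentralizer [IsAlgClosed K] [CharZero K]
    {G T : Subgroup (GL (Fin n) K)} (hT : IsMaximalTorus G T)
    (hG : IsZClosed (G : Set (GL (Fin n) K))) : LieRing.IsNilpotent (lieCentralizer G T) := by
  rw [LieAlgebra.isNilpotent_iff_forall (R := K)]
  rintro ⟨Y, hYG, hYT⟩
  obtain ⟨g, d, m, rfl, hm, hcom⟩ := exists_conjDiag_add_nilpotent Y
  have hmd : Commute m (conjDiag g d) := commute_of_commute_add (hcom _ (Commute.refl _))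
  have hs : ∀ Z ∈ lieCentralizer G T, Commute Z (conjDiag g d) := fun Z hZ =>
    hT.commute_conjDiag hG hYG hm hmd (fun t ht => hcom _ (hYT t ht).symm) hZ.2
  obtain ⟨k, hk⟩ := LieAlgebra.ad_nilpotent_of_nilpotent (R := K) hm
  have key : ∀ (k : ℕ) (Z : lieCentralizer G T),
      (((LieAlgebra.ad K (lieCentralizer G T) ⟨conjDiag g d + m, hYG, hYT⟩) ^ k) Z :
        Matrix (Fin n) (Fin n) K) = ((LieAlgebra.ad K (Matrix (Fin n) (Fin n) K) m) ^ k) Z := by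
    intro k
    induction k with
    | zero => exact fun Z => rfl
    | succ k ih =>
      intro Z
      rw [_root_.pow_succ, _root_.pow_succ, Module.End.mul_apply, Module.End.mul_apply, ih]
      congr 1
      rw [LieAlgebra.ad_apply, LieAlgebra.ad_apply, LieSubalgebra.coe_bracket, add_lie,
        Ring.lie_def (conjDiag g d), (hs Z Z.2).eq, sub_self, zero_add]
  refine ⟨k, LinearMap.ext fun Z => Subtype.ext ?_⟩
  rw [key, hk]
  rfl

lemma trace_mul_eq_zero_of_isNilpotent [IsAlgClosed K] [CharZero K]
    (L : LieSubalgebra K (Matrix (Fin n) (Fin n) K)) [LieRing.IsNilpotent L]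
    {x y : Matrix (Fin n) (Fin n) K} (hx : x ∈ L) (hy : y ∈ L) (hxn : IsNilpotent x) :
    trace (x * y) = 0 := by
  have h := LieModule.traceForm_eq_sum_finrank_nsmul_mul K L (Fin n → K) ⟨x, hx⟩ ⟨y, hy⟩
  have hend : ∀ (z : Matrix (Fin n) (Fin n) K) (hz : z ∈ L),
      LieModule.toEnd K L (Fin n → K) ⟨z, hz⟩ = toLin' z := fun z hz => rfl
  have hnil : IsNilpotent (LieModule.toEnd K L (Fin n → K) ⟨x, hx⟩) := by
    rw [hend]
    exact hxn.map (toLinAlgEquiv' (R := K) (n := Fin n))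
  rw [Finset.sum_eq_zero fun χ _ => by
    rw [χ.apply_eq_zero_of_isNilpotent _ hnil, zero_mul, smul_zero],
    LieModule.traceForm_apply_apply, hend, hend, ← toLin'_mul, trace_toLin'_eq] at h
  exact h

/-- A nilpotent element of the Lie algebra commuting with a maximal torus is in the radical of the
trace form. -/
lemma IsMaximalTorus.trace_mul_eq_zero [IsAlgClosed K] [CharZero K]
    {G T : Subgroup (GL (Fin n) K)} (hT : IsMaximalTorus G T)
    (hG : IsZClosed (G : Set (GL (Fin n) K))) {x : Matrix (Fin n) (Fin n) K}
    (hx : x ∈ lieCentralizer G T) (hxn : IsNilpotent x) : ∀ y ∈ lieAlg G, trace (x * y) = 0 := by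
  have := hT.isNilpotent_lieCentralizer hG
  obtain ⟨g, hg⟩ := hT.1.exists_conjDiagGL
  refine eq_zero_of_conj_invariant (T := T) (W := (lieAlg G).toSubmodule)
    (φ := traceLinearMap (Fin n) K K ∘ₗ LinearMap.mulLeft K x)
    (fun t ht => ⟨g, hg t ht⟩) (fun t ht t' ht' => ?_)
    (fun t ht Y hY => conj_mem_lieAlg (hT.2.1 ht) hY) (fun t ht Y hY => ?_)
    (fun Y hY hYT => ?_)
  · obtain ⟨d, rfl⟩ := hg t ht
    obtain ⟨d', rfl⟩ := hg t' ht'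
    exact conjDiagGL_commute _ _ _
  · change trace (x * (t.val * Y * (t⁻¹ : GL (Fin n) K).val)) = trace (x * Y)
    rw [mul_assoc, ← mul_assoc x, (hx.2 t ht).eq, mul_assoc, trace_mul_comm, mul_assoc,
      mul_assoc, GL_val_inv_mul_val, mul_one]
  · exact trace_mul_eq_zero_of_isNilpotent (lieCentralizer G T) hx ⟨hY, hYT⟩ hxn

/-- The radical of the trace form on the Lie algebra of a group. -/
def traceRadical (G : Subgroup (GL (Fin n) K)) :
    LieSubalgebra K (Matrix (Fin n) (Fin n) K) where
  carrier := {x | x ∈ lieAlg G ∧ ∀ y ∈ lieAlg G, trace (x * y) = 0}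
  add_mem' hx hx' := ⟨add_mem hx.1 hx'.1, fun y hy => by
    rw [add_mul, trace_add, hx.2 y hy, hx'.2 y hy, add_zero]⟩
  zero_mem' := ⟨zero_mem _, fun y _ => by rw [zero_mul, trace_zero]⟩
  smul_mem' c _ hx := ⟨(lieAlg G).smul_mem c hx.1, fun y hy => by
    rw [smul_mul_assoc, trace_smul, hx.2 y hy, smul_zero]⟩
  lie_mem' {x x'} hx hx' := ⟨(lieAlg G).lie_mem hx.1 hx'.1, fun y hy => by
    have := hx.2 _ ((lieAlg G).lie_mem hx'.1 hy)
    rw [Ring.lie_def, mul_sub, trace_sub] at this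
    rw [Ring.lie_def, sub_mul, trace_sub, mul_assoc, mul_assoc, trace_mul_comm x', mul_assoc]
    exact this⟩

lemma conj_mem_traceRadical {G : Subgroup (GL (Fin n) K)} {g : GL (Fin n) K} (hg : g ∈ G)
    {x : Matrix (Fin n) (Fin n) K} (hx : x ∈ traceRadical G) :
    g.val * x * (g⁻¹ : GL (Fin n) K).val ∈ traceRadical G := by
  refine ⟨conj_mem_lieAlg hg hx.1, fun y hy => ?_⟩
  have := hx.2 _ (conj_mem_lieAlg (G.inv_mem hg) hy)
  rw [inv_inv] at this
  rw [mul_assoc, mul_assoc, trace_mul_comm, ← this]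
  simp only [mul_assoc]

lemma isNilpotent_of_mem_traceRadical [IsAlgClosed K] [CharZero K] {G : Subgroup (GL (Fin n) K)}
    (hG : IsZClosed (G : Set (GL (Fin n) K))) {x : Matrix (Fin n) (Fin n) K}
    (hx : x ∈ traceRadical G) : IsNilpotent x := by
  obtain ⟨g, d, m, rfl, hm, hcom⟩ := exists_conjDiag_add_nilpotent x
  have hmd : Commute m (conjDiag g d) := commute_of_commute_add (hcom _ (Commute.refl _))
  obtain ⟨r, a, e, he, hd⟩ := exists_int_coordinates d
  have ha : ∀ i k, a i k = 0 := by
    intro i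
    have hmi : Commute m (conjDiag g fun k => (a i k : K)) :=
      hmd.conjDiag_of_imp fun j k hjk => by rw [int_coordinates_eq_of_eq he hd hjk i]
    have h := hx.2 _ (cochar_mem hG hx.1 hm hmd he hd i).1
    have hnil := Matrix.isNilpotent_trace_of_isNilpotent (hmi.isNilpotent_mul_right hm)
    rw [add_mul, trace_add, hnil.eq_zero, add_zero, conjDiag_mul, trace_conjDiag] at h
    have h' : ∑ j, ((∑ k, a j k * a i k : ℤ) : K) * e j = ∑ j, ((0 : ℤ) : K) * e j := by
      have hR : ∑ j, ((0 : ℤ) : K) * e j = 0 := by simp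
      rw [hR, ← h]
      simp only [Pi.mul_apply, hd, Int.cast_sum, Int.cast_mul, Finset.sum_mul]
      rw [Finset.sum_comm]
      exact Finset.sum_congr rfl fun k _ => Finset.sum_congr rfl fun j _ => by ring
    have h2 : ∑ k, a i k * a i k = 0 := congrFun (sum_intCast_mul_injective (K := K) he
      (a₁ := fun j => ∑ k, a j k * a i k) (a₂ := fun _ => 0) h') i
    rw [Finset.sum_eq_zero_iff_of_nonneg fun k _ => mul_self_nonneg _] at h2
    exact fun k => mul_self_eq_zero.1 (h2 k (Finset.mem_univ k))
  have : conjDiag g d = 0 := by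
    rw [conjDiag_eq_sum_smul g hd]
    refine Finset.sum_eq_zero fun i _ => ?_
    simp [conjDiag, ha]
  rwa [this, zero_add]

end TraceForm

section UnipotentRadical

attribute [local instance] LieRing.ofAssociativeRing

variable {n : ℕ}

lemma pow_eq_zero_of_isNilpotent {N : Matrix (Fin n) (Fin n) K} (hN : IsNilpotent N) : N ^ n = 0 := by
  have h := Matrix.aeval_self_charpoly N
  have hc : N.charpoly = Polynomial.X ^ n := by
    have h1 := Matrix.isNilpotent_charpoly_sub_pow_of_isNilpotent hN
    rw [Fintype.card_fin] at h1
    exact sub_eq_zero.1 h1.eq_zero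
  rwa [hc, map_pow, Polynomial.aeval_X] at h

/-- The decreasing sequence of subspaces obtained by repeatedly applying a space of matrices. -/
def matFlag (𝔫 : Submodule K (Matrix (Fin n) (Fin n) K)) : ℕ → Submodule K (Fin n → K)
  | 0 => ⊤
  | i + 1 => Submodule.span K {w | ∃ x ∈ 𝔫, ∃ v ∈ matFlag 𝔫 i, x *ᵥ v = w}

variable {𝔫 : Submodule K (Matrix (Fin n) (Fin n) K)}

lemma mulVec_mem_matFlag {x : Matrix (Fin n) (Fin n) K} (hx : x ∈ 𝔫) {i : ℕ} {v : Fin n → K}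
    (hv : v ∈ matFlag 𝔫 i) : x *ᵥ v ∈ matFlag 𝔫 (i + 1) :=
  Submodule.subset_span ⟨x, hx, v, hv, rfl⟩

lemma matFlag_succ_le (i : ℕ) : matFlag 𝔫 (i + 1) ≤ matFlag 𝔫 i := by
  induction i with
  | zero => exact le_top
  | succ i ih =>
    refine Submodule.span_le.2 ?_
    rintro _ ⟨x, hx, v, hv, rfl⟩
    exact mulVec_mem_matFlag hx (ih hv)

lemma mulVec_mem_matFlag_of_conj {g : GL (Fin n) K}
    (hg : ∀ x ∈ 𝔫, g.val * x * (g⁻¹ : GL (Fin n) K).val ∈ 𝔫) {i : ℕ} :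
    ∀ {v : Fin n → K}, v ∈ matFlag 𝔫 i → g.val *ᵥ v ∈ matFlag 𝔫 i := by
  induction i with
  | zero => exact fun _ => Submodule.mem_top
  | succ i ih =>
    intro v hv
    suffices matFlag 𝔫 (i + 1) ≤ (matFlag 𝔫 (i + 1)).comap (toLin' g.val) from this hv
    refine Submodule.span_le.2 ?_
    rintro _ ⟨x, hx, v, hv, rfl⟩
    have := mulVec_mem_matFlag (hg x hx) (ih hv)
    rwa [mulVec_mulVec, mul_assoc, GL_val_inv_mul_val, mul_one, ← mulVec_mulVec] at this

lemma exists_matFlag_eq_bot (L : LieSubalgebra K (Matrix (Fin n) (Fin n) K))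
    (hL : ∀ x ∈ L, IsNilpotent x) : ∃ k, matFlag L.toSubmodule k = ⊥ := by
  have h : LieModule.IsNilpotent L (Fin n → K) := by
    rw [LieModule.isNilpotent_iff_forall' (R := K)]
    rintro ⟨x, hx⟩
    exact (hL x hx).map (toLinAlgEquiv' (R := K) (n := Fin n))
  obtain ⟨k, hk⟩ := (LieModule.isNilpotent_iff K L (Fin n → K)).1 h
  refine ⟨k, le_bot_iff.1 ?_⟩
  have hle : ∀ i, matFlag L.toSubmodule i ≤
      (LieModule.lowerCentralSeries K L (Fin n → K) i).toSubmodule := by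
    intro i
    induction i with
    | zero => exact fun _ _ => Submodule.mem_top
    | succ i ih =>
      refine Submodule.span_le.2 ?_
      rintro _ ⟨x, hx, v, hv, rfl⟩
      rw [LieModule.lowerCentralSeries_succ]
      exact LieSubmodule.lie_mem_lie (LieSubmodule.mem_top (⟨x, hx⟩ : L)) (ih hv)
  have := hle k
  rwa [hk] at this

/-- The matrices shifting the flag of `𝔫`. -/
def flagNil (𝔫 : Submodule K (Matrix (Fin n) (Fin n) K)) :
    Submodule K (Matrix (Fin n) (Fin n) K) where
  carrier := {x | ∀ i, ∀ v ∈ matFlag 𝔫 i, x *ᵥ v ∈ matFlag 𝔫 (i + 1)}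
  add_mem' hx hy i v hv := by
    rw [add_mulVec]
    exact add_mem (hx i v hv) (hy i v hv)
  zero_mem' i v _ := by
    rw [zero_mulVec]
    exact zero_mem _
  smul_mem' c x hx i v hv := by
    rw [smul_mulVec]
    exact Submodule.smul_mem _ c (hx i v hv)

lemma mul_mem_flagNil {x y : Matrix (Fin n) (Fin n) K} (hx : x ∈ flagNil 𝔫) (hy : y ∈ flagNil 𝔫) :
    x * y ∈ flagNil 𝔫 := fun i v hv => by
  rw [← mulVec_mulVec]
  exact hx i _ (matFlag_succ_le i (hy i v hv))

lemma isNilpotent_of_mem_flagNil {k : ℕ} (hk : matFlag 𝔫 k = ⊥) {x : Matrix (Fin n) (Fin n) K}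
    (hx : x ∈ flagNil 𝔫) : IsNilpotent x := by
  have h : ∀ (i : ℕ) (v : Fin n → K), x ^ i *ᵥ v ∈ matFlag 𝔫 i := by
    intro i
    induction i with
    | zero => exact fun _ => Submodule.mem_top
    | succ i ih =>
      intro v
      rw [_root_.pow_succ', ← mulVec_mulVec]
      exact hx i _ (ih v)
  refine ⟨k, Matrix.ext_of_mulVec_single fun j => ?_⟩
  have := h k (Pi.single j 1)
  rw [hk, Submodule.mem_bot] at this
  rw [this, zero_mulVec]

/-- The matrices that act trivially on the quotients of the flag of `𝔫`. -/
def flagUnipotent (𝔫 : Submodule K (Matrix (Fin n) (Fin n) K)) : Subgroup (GL (Fin n) K) where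
  carrier := {g | g.val - 1 ∈ flagNil 𝔫}
  one_mem' := by
    rw [Set.mem_ofPred_eq, Units.val_one, sub_self]
    exact zero_mem _
  mul_mem' {g h} hg hh := by
    have : (g * h).val - 1 = (g.val - 1) * (h.val - 1) + (g.val - 1) + (h.val - 1) := by
      rw [Units.val_mul]
      noncomm_ring
    rw [Set.mem_ofPred_eq, this]
    exact add_mem (add_mem (mul_mem_flagNil hg hh) hg) hh
  inv_mem' {g} hg i v hv := by
    have hle : (matFlag 𝔫 i).map (toLin' g.val) ≤ matFlag 𝔫 i := by
      rintro _ ⟨w, hw, rfl⟩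
      have := add_mem (matFlag_succ_le i (hg i w hw)) hw
      rwa [sub_mulVec, one_mulVec, sub_add_cancel] at this
    have hinj : Function.Injective (toLin' g.val) := mulVec_injective_of_isUnit g.isUnit
    rw [← Submodule.eq_of_le_of_finrank_eq hle
      (Submodule.equivMapOfInjective _ hinj _).finrank_eq.symm] at hv
    obtain ⟨w, hw, rfl⟩ := hv
    have := neg_mem (hg i w hw)
    rw [sub_mulVec, one_mulVec, neg_sub] at this
    rwa [toLin'_apply, sub_mulVec, one_mulVec, mulVec_mulVec, GL_val_inv_mul_val, one_mulVec]

lemma mem_flagUnipotent {g : GL (Fin n) K} :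
    g ∈ flagUnipotent 𝔫 ↔ g.val - 1 ∈ flagNil 𝔫 := Iff.rfl

lemma expGL_mem_flagUnipotent [CharZero K] {x : Matrix (Fin n) (Fin n) K} (hx : x ∈ 𝔫)
    (hxn : IsNilpotent x) : expGL x hxn ∈ flagUnipotent 𝔫 := by
  have hx' : x ∈ flagNil 𝔫 := fun i v hv => mulVec_mem_matFlag hx hv
  have hpow : ∀ k, x ^ (k + 1) ∈ flagNil 𝔫 := by
    intro k
    induction k with
    | zero => rwa [zero_add, pow_one]
    | succ k ih =>
      rw [_root_.pow_succ]
      exact mul_mem_flagNil ih hx'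
  obtain ⟨k, hk⟩ := id hxn
  rw [mem_flagUnipotent, expGL_val,
    IsNilpotent.exp_eq_sum (k := k + 1) (by rw [_root_.pow_succ, hk, zero_mul]),
    Finset.sum_range_succ']
  simp only [pow_zero, Nat.factorial_zero, Nat.cast_one, inv_one, one_smul, add_sub_cancel_right]
  exact sum_mem fun j _ => Submodule.smul_of_tower_mem _ _ (hpow j)

lemma isZClosed_flagUnipotent : IsZClosed (flagUnipotent 𝔫 : Set (GL (Fin n) K)) := by
  let ι := {q : ℕ × (Fin n → K) × Module.Dual K (Fin n → K) //
    q.2.1 ∈ matFlag 𝔫 q.1 ∧ matFlag 𝔫 (q.1 + 1) ≤ LinearMap.ker q.2.2}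
  convert isZClosed_setOf_linear (fun q : ι => q.1.2.2 ∘ₗ (mulVecBilin K K).flip q.1.2.1)
    (fun q : ι => q.1.2.2 q.1.2.1)
  ext g
  constructor
  · rintro hg ⟨⟨i, v, φ⟩, hv, hφ⟩
    have := LinearMap.mem_ker.1 (hφ (hg i v hv))
    rw [sub_mulVec, one_mulVec, map_sub, sub_eq_zero] at this
    exact this
  · intro hg i v hv
    by_contra hmem
    obtain ⟨φ, hφ, hle⟩ := Submodule.exists_le_ker_of_notMem hmem
    refine hφ ?_
    rw [sub_mulVec, one_mulVec, map_sub, sub_eq_zero]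
    exact hg ⟨(i, v, φ), hv, hle⟩

lemma IsZClosed.inter {s t : Set (GL (Fin n) K)} (hs : IsZClosed s) (ht : IsZClosed t) :
    IsZClosed (s ∩ t) := by
  obtain ⟨I, rfl⟩ := hs
  obtain ⟨J, rfl⟩ := ht
  refine ⟨I ∪ J, ?_⟩
  ext A
  simp only [Set.mem_inter_iff, Set.mem_ofPred_eq, Set.mem_union, or_imp, forall_and]

/-- A closed subgroup consisting of unipotent elements is connected. -/
lemma isConnectedSG_of_isNilpotent [CharZero K] {U : Subgroup (GL (Fin n) K)}
    (hU : IsZClosed (U : Set (GL (Fin n) K)))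
    (hun : ∀ u ∈ U, IsNilpotent (u.val - 1)) : IsConnectedSG U := by
  have key : ∀ {s t : Set (GL (Fin n) K)}, IsZClosed s → IsZClosed t →
      (U : Set (GL (Fin n) K)) ⊆ s ∪ t → (U : Set (GL (Fin n) K)) ∩ s ∩ t = ∅ → 1 ∈ s →
      (U : Set (GL (Fin n) K)) ⊆ s := by
    intro s t hs ht hst hdisj h1 u hu
    obtain ⟨N, hN, rfl⟩ := exists_expGL_eq (hun u hu)
    have hmem := hU.expGL_smul_mem hN (fun k => U.pow_mem hu k)
    rcases forall_mem_or_forall_mem_of_curve (γ := fun c : K => expGL (c • N) (hN.smul c))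
      (ε := id) (by rw [Set.range_id]; exact Set.infinite_univ)
      (fun p => ⟨expCurve N p, fun c => by rw [eval_expCurve hN]; rfl⟩) hs ht
      (fun c => hst (hmem c)) with h | h
    · simpa only [one_smul] using h 1
    · have h0 := h 0
      rw [expGL_zero_smul N hN] at h0
      exact ((Set.ext_iff.1 hdisj 1).1 ⟨⟨U.one_mem, h1⟩, h0⟩).elim
  intro s t hs ht hst hdisj
  rcases hst U.one_mem with h | h
  · exact Or.inl (key hs ht hst hdisj h)
  · exact Or.inr (key ht hs (by rwa [Set.union_comm]) (by rwa [Set.inter_right_comm]) h)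

/-- The radical of the trace form on the Lie algebra of a reductive group is trivial. -/
lemma IsReductive.expGL_eq_one [IsAlgClosed K] [CharZero K] {G : Subgroup (GL (Fin n) K)}
    (hG : IsReductive G) {x : Matrix (Fin n) (Fin n) K} (hx : x ∈ traceRadical G)
    (hxn : IsNilpotent x) : expGL x hxn = 1 := by
  obtain ⟨hcl, -, hU⟩ := hG
  obtain ⟨k, hk⟩ := exists_matFlag_eq_bot (traceRadical G)
    fun x hx => isNilpotent_of_mem_traceRadical hcl hx
  set 𝔫 := (traceRadical G).toSubmodule
  have hun : ∀ u ∈ G ⊓ flagUnipotent 𝔫, IsNilpotent (u.val - 1) := fun u hu =>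
    isNilpotent_of_mem_flagNil hk hu.2
  have hclU : IsZClosed ((G ⊓ flagUnipotent 𝔫 : Subgroup (GL (Fin n) K)) : Set (GL (Fin n) K)) :=
    hcl.inter isZClosed_flagUnipotent
  have hbot := hU (G ⊓ flagUnipotent 𝔫) inf_le_left hclU (isConnectedSG_of_isNilpotent hclU hun)
    (fun g hg u hu => ⟨G.mul_mem (G.mul_mem hg hu.1) (G.inv_mem hg), fun i v hv => by
      have heq : (g * u * g⁻¹).val - 1 = g.val * (u.val - 1) * (g⁻¹ : GL (Fin n) K).val := by
        rw [mul_sub, sub_mul, mul_one, GL_val_mul_val_inv]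
        rfl
      have hv' := mulVec_mem_matFlag_of_conj (𝔫 := 𝔫)
        (fun x hx => conj_mem_traceRadical (G.inv_mem hg) hx) hv
      have := mulVec_mem_matFlag_of_conj (𝔫 := 𝔫)
        (fun x hx => conj_mem_traceRadical hg hx) (hu.2 i _ hv')
      rwa [heq, ← mulVec_mulVec, ← mulVec_mulVec]⟩)
    (fun u hu => pow_eq_zero_of_isNilpotent (hun u hu))
  have hmem : expGL x hxn ∈ G ⊓ flagUnipotent 𝔫 :=
    Subgroup.mem_inf.2 ⟨by simpa only [one_smul] using expGL_mem hcl hxn hx.1 1,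
      expGL_mem_flagUnipotent hx hxn⟩
  rwa [hbot, Subgroup.mem_bot] at hmem

/-- The differential of an additive character of a closed subgroup containing a maximal torus of a
reductive group is trivial. -/
lemma IsReductive.differential_eq_zero [IsAlgClosed K] [CharZero K] {G H : Subgroup (GL (Fin n) K)}
    (hG : IsReductive G) (hHG : H ≤ G) (hHcl : IsZClosed (H : Set (GL (Fin n) K)))
    (hT : ∃ T : Subgroup (GL (Fin n) K), IsMaximalTorus G T ∧ T ≤ H) {F : MatPoly n K}
    (hF : IsAdditiveOn H F) : ∀ Y ∈ lieAlg H, differential F Y = 0 := by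
  obtain ⟨T, hTG, hTH⟩ := hT
  obtain ⟨g₁, hg₁⟩ := hTG.1.exists_conjDiagGL
  have hfix : ∀ Y ∈ (lieAlg H).toSubmodule, (∀ t ∈ (T : Set (GL (Fin n) K)), Commute Y t.val) →
      differential F Y = 0 := by
    intro Y hY hYT
    obtain ⟨g, d, m, rfl, hm, hcom⟩ := exists_conjDiag_add_nilpotent Y
    have hmd : Commute m (conjDiag g d) := commute_of_commute_add (hcom _ (Commute.refl _))
    have hs : conjDiag g d ∈ lieAlg H := conjDiag_mem_lieAlg hHcl hY hm hmd
    have hmH : m ∈ lieAlg H := by simpa using sub_mem hY hs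
    have hmT : ∀ t ∈ (T : Set (GL (Fin n) K)), Commute m t.val := fun t ht => by
      simpa using (hYT t ht).sub_left (hcom _ (hYT t ht).symm).symm
    have hmG : m ∈ lieCentralizer G T := ⟨lieAlg_mono hHG hmH, hmT⟩
    have hexp := hG.expGL_eq_one ⟨hmG.1, hTG.trace_mul_eq_zero hG.1 hmG hm⟩ hm
    rw [map_add, hF.differential_conjDiag hs, zero_add, ← hF.eval_expGL hm hmH, hexp, hF.eval_one]
  exact eq_zero_of_conj_invariant (T := (T : Set (GL (Fin n) K)))
    (fun t ht => ⟨g₁, hg₁ t ht⟩)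
    (fun t ht t' ht' => by
      obtain ⟨d, rfl⟩ := hg₁ t ht
      obtain ⟨d', rfl⟩ := hg₁ t' ht'
      exact conjDiagGL_commute _ _ _)
    (fun t ht Y hY => conj_mem_lieAlg (hTH ht) hY)
    (fun t ht Y hY => hF.differential_conj (hTH ht) hY) hfix

end UnipotentRadical

/-- Lemma 2.3.6, additive case. Over an algebraically closed field of
characteristic 0, if `H` is a closed subgroup of a reductive group `G` containing a maximal
torus of `G`, then every homomorphism of algebraic groups `H → G_a` is trivial. -/
theorem ga_hom_trivial_of_contains_maximal_torus
    {K : Type} [Field K] [IsAlgClosed K] [CharZero K] {n : ℕ}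
    (G H : Subgroup (GL (Fin n) K)) (hG : IsReductive G) (hHG : H ≤ G)
    (hHcl : IsZClosed (H : Set (GL (Fin n) K)))
    (hT : ∃ T : Subgroup (GL (Fin n) K), IsMaximalTorus G T ∧ T ≤ H)
    (f : GaHom H) : ∀ A : H, f.toFun A = 0 := by
  obtain ⟨F, hfF⟩ := f.poly
  have hF : IsAdditiveOn H F := fun A hA B hB => by
    have := f.map_mul ⟨A, hA⟩ ⟨B, hB⟩
    rwa [hfF, hfF, hfF] at this
  intro A
  by_contra hA
  rw [hfF] at hA
  obtain ⟨N, hN, hN0⟩ := hF.exists_differential_ne_zero hHcl A.2 hA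
  exact hN0 (hG.differential_eq_zero hHG hHcl hT hF N hN)
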